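/- arXiv:1808.05433 — 7 statements merged into one kernel-verified Lean document; each statement's English description precedes it below -/
import Mathlib

section
/- For a positive integer n, let D_n be the one-dimensional tile consisting of n intervals of length 2 separated by gaps of length 1; concretely D_n = {x ∈ ℤ : 0 ≤ x ≤ 3n − 2 and x ≢ 2 (mod 3)}. Then for every positive integer d, if n > 3^{d−1}, then D_n does not tile ℤ^d. -/
/-- The one-dimensional tile `k(m)ℓ`: an interval of length `k`, a gap of
length `m`, and an interval of length `ℓ`. -/
def punctTile (k m l : ℕ) : Set ℤ :=
  {x : ℤ | (0 ≤ x ∧ x < (k : ℤ)) ∨ ((k : ℤ) + m ≤ x ∧ x < (k : ℤ) + m + l)}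

/-- `P` is a copy of the one-dimensional tile `T` in `ℤ^d`: the image of `T`
under `x ↦ v + x • e i` or `x ↦ v - x • e i` for some axis `i` and `v ∈ ℤ^d`. -/
def IsCopy (d : ℕ) (T : Set ℤ) (P : Set (Fin d → ℤ)) : Prop :=
  ∃ (v : Fin d → ℤ) (i : Fin d) (ε : ℤ), (ε = 1 ∨ ε = -1) ∧
    P = (fun x : ℤ => fun j : Fin d => v j + if j = i then ε * x else 0) '' T

/-- The one-dimensional tile `T` tiles the subset `S ⊆ ℤ^d`. -/
def Tiles (d : ℕ) (T : Set ℤ) (S : Set (Fin d → ℤ)) : Prop :=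
  ∃ F : Set (Set (Fin d → ℤ)),
    (∀ P ∈ F, IsCopy d T P) ∧ F.Pairwise Disjoint ∧ ⋃₀ F = S

/-- The one-dimensional tile `T` tiles `ℤ^d`. -/
def TilesZd (d : ℕ) (T : Set ℤ) : Prop := Tiles d T Set.univ
/-- The tile `D_n`: `n` intervals of length `2` separated by gaps of length `1`. -/
def Dn (n : ℕ) : Set ℤ :=
  {x : ℤ | 0 ≤ x ∧ x ≤ 3 * (n : ℤ) - 2 ∧ x % 3 ≠ 2}

/-- Parametrization of a copy. -/
def cellMap {d : ℕ} (v : Fin d → ℤ) (i : Fin d) (ε : ℤ) (x : ℤ) : Fin d → ℤ :=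
  fun j : Fin d => v j + if j = i then ε * x else 0

lemma cellMap_self {d : ℕ} (v : Fin d → ℤ) (i : Fin d) (ε x : ℤ) :
    cellMap v i ε x i = v i + ε * x := by simp [cellMap]

lemma cellMap_ne {d : ℕ} (v : Fin d → ℤ) (i : Fin d) (ε x : ℤ) {j : Fin d} (h : j ≠ i) :
    cellMap v i ε x j = v j := by simp [cellMap, h]

lemma cellMap_inj {d : ℕ} (v : Fin d → ℤ) (i : Fin d) (ε : ℤ) (hε : ε = 1 ∨ ε = -1) :
    Function.Injective (cellMap v i ε) := by
  intro x y h
  have := congrFun h i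
  rw [cellMap_self, cellMap_self] at this
  rcases hε with rfl | rfl <;> omega

open Classical in
/-- A window of length three meeting `D_n` in an odd number of cells is at an end. -/
lemma window_odd (n : ℕ) (hn : 0 < n) (s : ℤ)
    (h : Odd ((Finset.Icc s (s + 2)).filter (fun x => x ∈ Dn n)).card) :
    s + 1 = -1 ∨ s + 1 = 3 * n - 1 := by
  have e : Finset.Icc s (s + 2) = {s, s + 1, s + 2} := by
    ext x; simp only [Finset.mem_Icc, Finset.mem_insert, Finset.mem_singleton]; omega
  rw [e, Finset.card_filter, Finset.sum_insert (by simp), Finset.sum_insert (by simp),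
    Finset.sum_singleton] at h
  rw [Nat.odd_iff] at h
  by_cases h1 : s ∈ Dn n <;> by_cases h2 : s + 1 ∈ Dn n <;> by_cases h3 : s + 2 ∈ Dn n <;>
  simp only [h1, h2, h3, if_true, if_false] at h <;>
  simp only [Dn, Set.mem_ofPred_eq] at h1 h2 h3 <;> omega

open Classical in
/-- Every cube of side three meets some tile only at an end of that tile. -/
lemma cube_end {d n : ℕ} (hn : 0 < n) {ι : Type} (v : ι → Fin d → ℤ) (i : ι → Fin d)
    (ε : ι → ℤ) (hε : ∀ t, ε t = 1 ∨ ε t = -1) (tile : (Fin d → ℤ) → ι)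
    (pos : (Fin d → ℤ) → ℤ)
    (hpos : ∀ q, pos q ∈ Dn n ∧ cellMap (v (tile q)) (i (tile q)) (ε (tile q)) (pos q) = q)
    (huniq : ∀ t x, x ∈ Dn n → tile (cellMap (v t) (i t) (ε t) x) = t)
    (c : Fin d → ℤ) :
    ∃ t : ι, ∃ y : ℤ, (y = -1 ∨ y = 3 * n - 1) ∧ c (i t) + 1 = v t (i t) + ε t * y ∧
      ∀ j, j ≠ i t → c j ≤ v t j ∧ v t j ≤ c j + 2 := by
  set Q := Fintype.piFinset (fun j => Finset.Icc (c j) (c j + 2)) with hQ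
  have hcard : Q.card = 3 ^ d := by
    rw [hQ, Fintype.card_piFinset]
    have : ∀ j, (Finset.Icc (c j) (c j + 2)).card = 3 := by intro j; simp; omega
    simp [this]
  have hodd : ∃ t ∈ Q.image tile, Odd (Q.filter (fun q => tile q = t)).card := by
    by_contra hcon
    push Not at hcon
    have h1 := Finset.card_eq_sum_card_image tile Q
    have h2 : Even (∑ b ∈ Q.image tile, (Q.filter (fun q => tile q = b)).card) :=
      Finset.even_sum _ fun t ht => by simpa using hcon t ht
    rw [← h1, hcard] at h2
    exact (Nat.not_even_iff_odd.2 (Odd.pow (by decide))) h2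
  obtain ⟨t, ht, hto⟩ := hodd
  obtain ⟨q0, hq0, rfl⟩ := Finset.mem_image.1 ht
  set t := tile q0
  have hside : ∀ j, j ≠ i t → c j ≤ v t j ∧ v t j ≤ c j + 2 := by
    intro j hj
    have h1 := (Finset.mem_Icc.1 ((Fintype.mem_piFinset.1 hq0) j))
    rw [← (hpos q0).2, cellMap_ne _ _ _ _ hj] at h1
    exact h1
  set s : ℤ := ε t * (c (i t) + 1 - v t (i t)) - 1 with hs
  have hfib : Q.filter (fun q => tile q = t) =
      ((Finset.Icc s (s + 2)).filter (fun x => x ∈ Dn n)).image (cellMap (v t) (i t) (ε t)) := by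
    ext q
    simp only [Finset.mem_filter, Finset.mem_image, hQ, Fintype.mem_piFinset, Finset.mem_Icc]
    constructor
    · rintro ⟨h1, h2⟩
      have h3 := hpos q
      rw [h2] at h3
      refine ⟨pos q, ⟨?_, h3.1⟩, h3.2⟩
      have h4 := h1 (i t)
      rw [← h3.2, cellMap_self] at h4
      rcases hε t with h | h <;> rw [h] at hs h4 <;> constructor <;> omega
    · rintro ⟨x, ⟨h1, h2⟩, rfl⟩
      refine ⟨fun j => ?_, huniq t x h2⟩
      by_cases hj : j = i t
      · subst hj
        rw [cellMap_self]
        rcases hε t with h | h <;> rw [h] at hs ⊢ <;> constructor <;> omega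
      · rw [cellMap_ne _ _ _ _ hj]; exact hside j hj
  rw [hfib, Finset.card_image_of_injective _ (cellMap_inj _ _ _ (hε t))] at hto
  refine ⟨t, s + 1, window_odd n hn s hto, ?_, hside⟩
  rcases hε t with h | h <;> rw [h] at hs ⊢ <;> omega

/-- The counting inequality in a box of side `M`. -/
lemma count_box {d n : ℕ} (hn : 0 < n) {ι : Type} (v : ι → Fin d → ℤ) (i : ι → Fin d)
    (ε : ι → ℤ) (hε : ∀ t, ε t = 1 ∨ ε t = -1) (tile : (Fin d → ℤ) → ι)
    (pos : (Fin d → ℤ) → ℤ)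
    (hpos : ∀ q, pos q ∈ Dn n ∧ cellMap (v (tile q)) (i (tile q)) (ε (tile q)) (pos q) = q)
    (huniq : ∀ t x, x ∈ Dn n → tile (cellMap (v t) (i t) (ε t) x) = t) (M : ℕ) :
    M ^ d * (n * 3) ≤ (M + 6 * n + 1) ^ d * 3 ^ d := by
  classical
  choose T Y hY hc hside using cube_end hn v i ε hε tile pos hpos huniq
  set X : (Fin d → ℤ) → ℤ → ℤ := fun c k => if Y c = -1 then 3 * k else 3 * n - 2 - 3 * k with hX
  set A := (Fintype.piFinset (fun _ : Fin d => Finset.Icc (0:ℤ) (M - 1))) ×ˢ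
    (Finset.Icc (0:ℤ) (n - 1) ×ˢ Finset.Icc (0:ℤ) 2) with hA
  set B := (Fintype.piFinset (fun _ : Fin d => Finset.Icc (-(3 * n) : ℤ) (M + 3 * n))) ×ˢ
    (Fintype.piFinset (fun _ : Fin d => Finset.Icc (0:ℤ) 2)) with hB
  have hXD : ∀ c k, 0 ≤ k → k ≤ (n:ℤ) - 1 → X c k ∈ Dn n := by
    intro c k h0 h1
    simp only [hX, Dn, Set.mem_ofPred_eq]
    split_ifs <;> omega
  let g : (Fin d → ℤ) × (ℤ × ℤ) → (Fin d → ℤ) × (Fin d → ℤ) := fun a =>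
    (cellMap (v (T a.1)) (i (T a.1)) (ε (T a.1)) (X a.1 a.2.1),
      Function.update (fun j => v (T a.1) j - a.1 j) (i (T a.1)) a.2.2)
  have hle : A.card ≤ B.card := by
    refine Finset.card_le_card_of_injOn g ?_ ?_
    · rintro ⟨c, k, u⟩ ha
      simp only [hA, Finset.coe_product, Set.mem_prod, Finset.mem_coe, Fintype.mem_piFinset,
        Finset.mem_Icc] at ha
      obtain ⟨h1, h2, h3⟩ := ha
      simp only [hB, g, Finset.coe_product, Set.mem_prod, Finset.mem_coe, Fintype.mem_piFinset,
        Finset.mem_Icc]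
      refine ⟨fun j => ?_, fun j => ?_⟩
      · by_cases hj : j = i (T c)
        · subst hj
          rw [cellMap_self]
          have a1 := h1 (i (T c))
          have a2 := hc c
          have a3 := hY c
          have a4 : X c k = if Y c = -1 then 3 * k else 3 * n - 2 - 3 * k := rfl
          rcases hε (T c) with h | h <;> rw [h] at a2 ⊢ <;> split_ifs at a4 <;>
            constructor <;> omega
        · rw [cellMap_ne _ _ _ _ hj]
          have a1 := h1 j
          have a2 := hside c j hj
          constructor <;> omega
      · by_cases hj : j = i (T c)
        · subst hj
          rw [Function.update_self]; exact h3
        · rw [Function.update_of_ne hj]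
          have a2 := hside c j hj
          constructor <;> omega
    · rintro ⟨c, k, u⟩ ha ⟨c', k', u'⟩ ha' hg
      simp only [hA, Finset.coe_product, Set.mem_prod, Finset.mem_coe, Fintype.mem_piFinset,
        Finset.mem_Icc] at ha ha'
      obtain ⟨h1, h2, h3⟩ := ha
      obtain ⟨h1', h2', h3'⟩ := ha'
      simp only [g, Prod.mk.injEq] at hg
      obtain ⟨e1, e2⟩ := hg
      have hT : T c = T c' := by
        rw [← huniq (T c) _ (hXD c k h2.1 h2.2), e1, huniq (T c') _ (hXD c' k' h2'.1 h2'.2)]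
      have b1 := hc c
      have b2 := hside c
      have b1' := hc c'
      have b2' := hside c'
      rw [hT] at e1 e2 b1 b2
      have eX := cellMap_inj _ _ _ (hε _) e1
      have y1 := hY c
      have y1' := hY c'
      have a4 : X c k = if Y c = -1 then 3 * k else 3 * n - 2 - 3 * k := rfl
      have a4' : X c' k' = if Y c' = -1 then 3 * k' else 3 * n - 2 - 3 * k' := rfl
      have hYk : Y c = Y c' ∧ k = k' := by
        split_ifs at a4 a4' <;> constructor <;> omega
      obtain ⟨hYe, rfl⟩ := hYk
      rw [hYe] at b1
      have hu : u = u' := by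
        have := congrFun e2 (i (T c'))
        simpa using this
      have hcc : c = c' := by
        funext j
        by_cases hj : j = i (T c')
        · subst hj; omega
        · have := congrFun e2 j
          rw [Function.update_of_ne hj, Function.update_of_ne hj] at this
          omega
      rw [hcc, hu]
  rw [hA, hB] at hle
  simp only [Finset.card_product, Fintype.card_piFinset, Int.card_Icc, Finset.prod_const,
    Finset.card_univ, Fintype.card_fin] at hle
  have r1 : ((M:ℤ) - 1 + 1 - 0).toNat = M := by omega
  have r2 : ((n:ℤ) - 1 + 1 - 0).toNat = n := by omega
  have r3 : ((M:ℤ) + 3 * n + 1 - -(3 * n)).toNat = M + 6 * n + 1 := by omega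
  have r4 : ((2:ℤ) + 1 - 0).toNat = 3 := by omega
  rw [r1, r2, r3, r4] at hle
  exact hle

/-- Passing to the limit. -/
lemma limit_ineq (d a b C : ℕ) (h : ∀ M : ℕ, M ^ d * a ≤ (M + C) ^ d * b) : a ≤ b := by
  have h1 : Filter.Tendsto (fun M : ℕ => (1 + (C:ℝ) / M) ^ d * b) Filter.atTop
      (nhds ((1 + 0) ^ d * b)) :=
    ((tendsto_const_nhds.add (tendsto_const_div_atTop_nhds_zero_nat (C:ℝ))).pow d).mul_const _
  have h2 : (a:ℝ) ≤ (1 + 0) ^ d * b := by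
    refine ge_of_tendsto h1 ?_
    filter_upwards [Filter.eventually_gt_atTop 0] with M hM
    have hM' : (0:ℝ) < M := by exact_mod_cast hM
    have h3 : (M:ℝ) ^ d * a ≤ (M + C) ^ d * b := by exact_mod_cast h M
    have h4 : (M:ℝ) + C = M * (1 + C / M) := by field_simp
    rw [h4, mul_pow, mul_assoc] at h3
    exact le_of_mul_le_mul_left h3 (by positivity)
  have h5 : (a:ℝ) ≤ b := by simpa using h2
  exact_mod_cast h5

/-- If `n > 3^(d−1)`, then `D_n` does not tile `ℤ^d`. -/
theorem Dn_not_tiles (n d : ℕ) (hn : 0 < n) (hd : 0 < d) (h : 3 ^ (d - 1) < n) :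
    ¬ TilesZd d (Dn n) := by
  rintro ⟨F, hF, hdisj, hcov⟩
  have hF' : ∀ P : F, ∃ (v : Fin d → ℤ) (i : Fin d) (ε : ℤ), (ε = 1 ∨ ε = -1) ∧
    (P : Set (Fin d → ℤ)) = cellMap v i ε '' Dn n := fun P => hF P P.2
  choose v i ε hε himg using hF'
  have hq : ∀ q : Fin d → ℤ, ∃ P : F, ∃ x, x ∈ Dn n ∧ cellMap (v P) (i P) (ε P) x = q := by
    intro q
    have : q ∈ ⋃₀ F := by rw [hcov]; trivial
    obtain ⟨P, hP, hqP⟩ := this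
    refine ⟨⟨P, hP⟩, ?_⟩
    have := himg ⟨P, hP⟩
    simp only at this
    rw [this] at hqP
    exact hqP
  choose tile pos hpos using hq
  have huniq : ∀ t x, x ∈ Dn n → tile (cellMap (v t) (i t) (ε t) x) = t := by
    intro t x hx
    by_contra hne
    set q := cellMap (v t) (i t) (ε t) x with hqd
    have hd' := hdisj (tile q).2 t.2 (fun e => hne (Subtype.ext e))
    have m1 : q ∈ (tile q : Set (Fin d → ℤ)) := by rw [himg]; exact ⟨pos q, hpos q⟩
    have m2 : q ∈ (t : Set (Fin d → ℤ)) := by rw [himg t]; exact ⟨x, hx, rfl⟩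
    exact Set.disjoint_left.1 hd' m1 m2
  have key := limit_ineq d (n * 3) (3 ^ d) (6 * n + 1)
    (fun M => count_box hn v i ε hε tile pos hpos huniq M)
  have e : 3 ^ d = 3 ^ (d - 1) * 3 := by rw [← pow_succ]; congr 1; omega
  omega
end

section
/- For every positive integer d, there exists a finite nonempty tile T ⊆ ℤ which does not tile ℤ^d. (For instance, one may take T = D_n with n = 3^{d−1} + 1, where D_n = {x ∈ ℤ : 0 ≤ x ≤ 3n − 2 and x ≢ 2 (mod 3)}.) -/
/-- A symmetric sparse tile with `T - T` containing all of `[-m^2, m^2]`. -/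
noncomputable def sparseTile (m : ℕ) : Finset ℤ :=
  Finset.Ico (0 : ℤ) m ∪ (Finset.Icc (0 : ℤ) m).image (fun q => q * m) ∪
    (Finset.Ico (0 : ℤ) m).image (fun r => (m : ℤ) * m - r)

theorem mem_sparseTile (m : ℕ) (x : ℤ) : x ∈ sparseTile m ↔
    (0 ≤ x ∧ x < m) ∨ (∃ q : ℤ, (0 ≤ q ∧ q ≤ m) ∧ q * m = x) ∨
      (∃ r : ℤ, (0 ≤ r ∧ r < m) ∧ (m : ℤ) * m - r = x) := by
  simp only [sparseTile, Finset.mem_union, Finset.mem_image, Finset.mem_Ico, Finset.mem_Icc,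
    or_assoc]

theorem card_sparseTile (m : ℕ) (hm : 0 < m) : (sparseTile m).card ≤ 4 * m := by
  have h1 := Finset.card_union_le
    (Finset.Ico (0 : ℤ) m ∪ (Finset.Icc (0 : ℤ) m).image (fun q => q * m))
    ((Finset.Ico (0 : ℤ) m).image (fun r => (m : ℤ) * m - r))
  have h2 := Finset.card_union_le
    (Finset.Ico (0 : ℤ) m) ((Finset.Icc (0 : ℤ) m).image (fun q => q * m))
  have h3 := Finset.card_image_le (s := Finset.Icc (0 : ℤ) m) (f := fun q => q * (m : ℤ))
  have h4 := Finset.card_image_le (s := Finset.Ico (0 : ℤ) m) (f := fun r => (m : ℤ) * m - r)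
  have h5 : (Finset.Ico (0 : ℤ) m).card = m := by simp
  have h6 : (Finset.Icc (0 : ℤ) m).card = m + 1 := by simp
  unfold sparseTile
  omega

theorem sparseTile_bounds (m : ℕ) (x : ℤ) (hx : x ∈ sparseTile m) :
    0 ≤ x ∧ x ≤ (m : ℤ) * m := by
  rw [mem_sparseTile] at hx
  rcases hx with ⟨h0, h1⟩ | ⟨q, ⟨h0, h1⟩, rfl⟩ | ⟨r, ⟨h0, h1⟩, rfl⟩
  · exact ⟨h0, by nlinarith⟩
  · exact ⟨by positivity, by nlinarith⟩
  · exact ⟨by nlinarith, by nlinarith⟩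

theorem sparseTile_symm (m : ℕ) (x : ℤ) (hx : x ∈ sparseTile m) :
    (m : ℤ) * m - x ∈ sparseTile m := by
  rw [mem_sparseTile] at hx ⊢
  rcases hx with ⟨h0, h1⟩ | ⟨q, ⟨h0, h1⟩, rfl⟩ | ⟨r, ⟨h0, h1⟩, rfl⟩
  · exact Or.inr (Or.inr ⟨x, ⟨h0, h1⟩, rfl⟩)
  · exact Or.inr (Or.inl ⟨m - q, ⟨by omega, by omega⟩, by ring⟩)
  · left
    constructor <;> linarith

theorem sparseTile_diff_nonneg (m : ℕ) (hm : 0 < m) (t : ℤ) (h0 : 0 ≤ t)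
    (h1 : t ≤ (m : ℤ) * m) : ∃ a ∈ sparseTile m, ∃ b ∈ sparseTile m, t = a - b := by
  have hm' : (0 : ℤ) < m := by exact_mod_cast hm
  have e := Int.emod_add_mul_ediv (-t) m
  have r0 := Int.emod_nonneg (-t) hm'.ne'
  have r1 := Int.emod_lt_of_pos (-t) hm'
  set r := (-t) % (m : ℤ)
  set q := (-t) / (m : ℤ)
  refine ⟨(-q) * m, ?_, r, ?_, by linarith⟩
  · rw [mem_sparseTile]
    refine Or.inr (Or.inl ⟨-q, ⟨?_, ?_⟩, rfl⟩)
    · by_contra h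
      have : 1 ≤ q := by omega
      nlinarith
    · by_contra h
      have : q ≤ -m - 1 := by omega
      nlinarith
  · rw [mem_sparseTile]
    exact Or.inl ⟨r0, r1⟩

theorem sparseTile_diff (m : ℕ) (hm : 0 < m) (t : ℤ) (h0 : -((m : ℤ) * m) ≤ t)
    (h1 : t ≤ (m : ℤ) * m) : ∃ a ∈ sparseTile m, ∃ b ∈ sparseTile m, t = a - b := by
  rcases le_total 0 t with h | h
  · exact sparseTile_diff_nonneg m hm t h h1
  · obtain ⟨a, ha, b, hb, e⟩ := sparseTile_diff_nonneg m hm (-t) (by omega) (by omega)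
    exact ⟨b, hb, a, ha, by omega⟩

/-- By symmetry every copy of the sparse tile is a translate along an axis. -/
theorem isCopy_sparse (d m : ℕ) (P : Set (Fin d → ℤ))
    (h : IsCopy d (sparseTile m : Set ℤ) P) :
    ∃ (v : Fin d → ℤ) (i : Fin d), ∀ p, p ∈ P ↔
      ∃ x ∈ sparseTile m, p = v + Pi.single i x := by
  obtain ⟨v, i, ε, hε, rfl⟩ := h
  rcases hε with rfl | rfl
  · refine ⟨v, i, fun p => ?_⟩
    constructor
    · rintro ⟨x, hx, rfl⟩
      refine ⟨x, hx, ?_⟩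
      funext j
      simp [Pi.single_apply]
    · rintro ⟨x, hx, rfl⟩
      refine ⟨x, hx, ?_⟩
      funext j
      simp [Pi.single_apply]
  · refine ⟨v - Pi.single i ((m : ℤ) * m), i, fun p => ?_⟩
    constructor
    · rintro ⟨x, hx, rfl⟩
      refine ⟨_, sparseTile_symm m x hx, ?_⟩
      funext j
      by_cases hj : j = i
      · subst hj; simp; ring
      · simp [hj]
    · rintro ⟨x, hx, rfl⟩
      refine ⟨_, sparseTile_symm m x hx, ?_⟩
      funext j
      by_cases hj : j = i
      · subst hj; simp; ring
      · simp [hj]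

theorem sparse_count (d m : ℕ) (hm : 0 < m)
    (h : TilesZd d (sparseTile m : Set ℤ)) :
    (m * m) ^ d * (m * m + 1) ≤ (3 * (m * m)) ^ d * (d * (sparseTile m).card) := by
  obtain ⟨F, hF, hdis, hcov⟩ := h
  have hF' := fun P : F => isCopy_sparse d m P.1 (hF P.1 P.2)
  choose v i hv using hF'
  have hc : ∀ c : Fin d → ℤ, ∃ P : F, c ∈ P.1 := by
    intro c
    have : c ∈ ⋃₀ F := by rw [hcov]; trivial
    obtain ⟨P, hP, hcP⟩ := this
    exact ⟨⟨P, hP⟩, hcP⟩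
  choose P hP using hc
  have ht : ∀ c, ∃ x ∈ sparseTile m, c = v (P c) + Pi.single (i (P c)) x :=
    fun c => (hv (P c) c).1 (hP c)
  choose t htm hte using ht
  let A : Finset ((Fin d → ℤ) × ℤ) :=
    (Fintype.piFinset fun _ => Finset.Ico (0 : ℤ) (m * m)) ×ˢ Finset.Icc (0 : ℤ) (m * m)
  let B : Finset ((Fin d → ℤ) × (Fin d × ℤ)) :=
    (Fintype.piFinset fun _ => Finset.Ico (-(m * m) : ℤ) (2 * (m * m))) ×ˢ
      (Finset.univ ×ˢ sparseTile m)
  let f : (Fin d → ℤ) × ℤ → (Fin d → ℤ) × (Fin d × ℤ) := fun y =>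
    (v (P y.1) + Pi.single (i (P y.1)) y.2, (i (P y.1), t y.1))
  have hA : A.card = (m * m) ^ d * (m * m + 1) := by
    have e1 : ((m : ℤ) * m).toNat = m * m := by
      rw [← Nat.cast_mul]; exact Int.toNat_natCast _
    have e2 : ((m : ℤ) * m + 1).toNat = m * m + 1 := by
      have : ((m : ℤ) * m + 1) = ((m * m + 1 : ℕ) : ℤ) := by push_cast; ring
      rw [this]; exact Int.toNat_natCast _
    simp only [A, Finset.card_product, Fintype.card_piFinset, Int.card_Ico, Int.card_Icc,
      sub_zero, Finset.prod_const, Finset.card_univ, Fintype.card_fin, e1, e2]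
  have hB : B.card = (3 * (m * m)) ^ d * (d * (sparseTile m).card) := by
    have e1 : (2 * ((m : ℤ) * m) - -((m : ℤ) * m)).toNat = 3 * (m * m) := by
      have : (2 * ((m : ℤ) * m) - -((m : ℤ) * m)) = ((3 * (m * m) : ℕ) : ℤ) := by
        push_cast; ring
      rw [this]; exact Int.toNat_natCast _
    simp only [B, Finset.card_product, Fintype.card_piFinset, Int.card_Ico,
      Finset.prod_const, Finset.card_univ, Fintype.card_fin, e1]
  rw [← hA, ← hB]
  apply Finset.card_le_card_of_injOn f
  · rintro ⟨c, x⟩ hy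
    have hy' : (∀ j, 0 ≤ c j ∧ c j < (m : ℤ) * m) ∧ 0 ≤ x ∧ x ≤ (m : ℤ) * m := by
      simpa [A] using hy
    obtain ⟨hc, hx0, hx1⟩ := hy'
    have goal : (∀ j, -((m : ℤ) * m) ≤ (v (P c) + Pi.single (i (P c)) x : Fin d → ℤ) j ∧
        (v (P c) + Pi.single (i (P c)) x : Fin d → ℤ) j < 2 * ((m : ℤ) * m)) := by
      intro j
      have hj := congrFun (hte c) j
      have hb := sparseTile_bounds m _ (htm c)
      have hcj := hc j
      simp only [Pi.add_apply, Pi.single_apply] at hj ⊢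
      split_ifs at hj ⊢ <;> constructor <;> linarith
    simp only [B, f, Finset.mem_coe, Finset.mem_product, Fintype.mem_piFinset, Finset.mem_Ico,
      Finset.mem_univ, true_and]
    exact ⟨goal, htm c⟩
  · rintro ⟨c, x⟩ hy ⟨c', x'⟩ hy' hff
    have hx : 0 ≤ x ∧ x ≤ (m : ℤ) * m := by
      have := (Finset.mem_product.1 (Finset.mem_coe.1 hy)).2
      simpa using this
    have hx' : 0 ≤ x' ∧ x' ≤ (m : ℤ) * m := by
      have := (Finset.mem_product.1 (Finset.mem_coe.1 hy')).2
      simpa using this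
    simp only [f, Prod.mk.injEq] at hff
    obtain ⟨h1, h2, h3⟩ := hff
    have hPP : P c = P c' := by
      by_contra hne
      have hd := hdis (P c).2 (P c').2 (fun h => hne (Subtype.ext h))
      obtain ⟨a, ha, b, hb, hab⟩ := sparseTile_diff m hm (x - x') (by linarith) (by linarith)
      have m1 : v (P c) + Pi.single (i (P c)) a ∈ (P c).1 := (hv _ _).2 ⟨a, ha, rfl⟩
      have m2 : v (P c) + Pi.single (i (P c)) a ∈ (P c').1 := by
        refine (hv _ _).2 ⟨b, hb, ?_⟩
        rw [← h2] at h1 ⊢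
        have ea : a = x + (b - x') := by linarith
        have eb : b = x' + (b - x') := by ring
        rw [ea, Pi.single_add, ← add_assoc, h1, add_assoc, ← Pi.single_add, ← eb]
      exact Set.disjoint_left.1 hd m1 m2
    have hcc : c = c' := by
      rw [hte c, hte c', hPP, h3]
    subst hcc
    have := congrFun h1 (i (P c))
    simp only [Pi.add_apply, Pi.single_eq_same] at this
    simp only [Prod.mk.injEq, true_and]
    linarith

/-- For every positive `d` there is a finite nonempty one-dimensional tile that
does not tile `ℤ^d`. -/
theorem exists_tile_not_tiling (d : ℕ) (hd : 0 < d) :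
    ∃ T : Set ℤ, T.Finite ∧ T.Nonempty ∧ ¬ TilesZd d T := by
  have hK : 0 < d * 3 ^ d := by positivity
  have hm : 0 < 4 * (d * 3 ^ d) := by positivity
  refine ⟨(sparseTile (4 * (d * 3 ^ d)) : Set ℤ), Finset.finite_toSet _, ⟨0, ?_⟩, fun h => ?_⟩
  · rw [Finset.mem_coe, mem_sparseTile]
    exact Or.inl ⟨le_rfl, by exact_mod_cast hm⟩
  · have h1 := sparse_count d _ hm h
    have h2 := card_sparseTile _ hm
    generalize hmm : 4 * (d * 3 ^ d) = m at *
    have h3 : (3 * (m * m)) ^ d * (d * (sparseTile m).card) ≤ (m * m) ^ d * (m * m) := by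
      calc (3 * (m * m)) ^ d * (d * (sparseTile m).card)
          ≤ (3 * (m * m)) ^ d * (d * (4 * m)) := by gcongr
        _ = (m * m) ^ d * ((4 * (d * 3 ^ d)) * m) := by rw [mul_pow]; ring
        _ = (m * m) ^ d * (m * m) := by rw [hmm]
    have h4 : 0 < (m * m) ^ d := by positivity
    have h5 := le_trans h1 h3
    rw [Nat.mul_add] at h5
    omega
end

section
/- Let k and ℓ be positive integers with k + ℓ odd, and set K = k + ℓ + 1 (so K is even). Define A = {(x,y) ∈ ℤ² : x ≡ y (mod K), x ≡ 0 (mod 2)}, B = {(x,y) ∈ ℤ² : x ≡ y (mod K), x ≡ 1 (mod 2)}, and C = {(x,y) ∈ ℤ² : x ≡ y − 1 (mod K), x ≡ 0 (mod 2)}. Then A, B, C are pairwise disjoint, and the tile T = k(1)ℓ tiles each of ℤ² ∖ (A ∪ B), ℤ² ∖ (A ∪ C), and ℤ² ∖ (B ∪ C). -/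
/-- The copy in direction `i` whose gap is at coordinate `g`, on the line `p j = y`. -/
def gapCopy (k l : ℕ) (i j : Fin 2) (y g : ℤ) : Set (Fin 2 → ℤ) :=
  {p | p j = y ∧ g - k ≤ p i ∧ p i ≤ g + l ∧ p i ≠ g}

theorem gapCopy_isCopy (k l : ℕ) (i j : Fin 2) (hij : i ≠ j) (y g : ℤ) :
    IsCopy 2 (punctTile k 1 l) (gapCopy k l i j y g) := by
  have hcov : ∀ m : Fin 2, m = i ∨ m = j := by
    intro m; omega
  refine ⟨fun m => if m = i then g - k else y, i, 1, Or.inl rfl, ?_⟩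
  ext p
  simp only [gapCopy, punctTile, Set.mem_setOf_eq, Set.mem_image]
  constructor
  · rintro ⟨h1, h2, h3, h4⟩
    refine ⟨p i - (g - k), ?_, ?_⟩
    · push_cast; omega
    · funext m
      rcases hcov m with rfl | rfl
      · simp
      · simp [hij.symm, h1]
  · rintro ⟨x, hx, rfl⟩
    simp only [if_true, hij.symm, if_false]
    push_cast at hx
    omega

theorem tiles_lines (k l : ℕ) (i j : Fin 2) (hij : i ≠ j) (f : ℤ → ℤ)
    (S : Set (Fin 2 → ℤ))
    (hS : ∀ p, p ∈ S ↔ ¬ ((k : ℤ) + l + 1 ∣ p i - f (p j))) :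
    Tiles 2 (punctTile k 1 l) S := by
  refine ⟨{P | ∃ y n : ℤ, P = gapCopy k l i j y (f y + ((k : ℤ) + l + 1) * n)}, ?_, ?_, ?_⟩
  · rintro P ⟨y, n, rfl⟩
    exact gapCopy_isCopy k l i j hij y _
  · rintro P ⟨y, n, rfl⟩ Q ⟨y', n', rfl⟩ hne
    rw [Set.disjoint_left]
    rintro p ⟨h1, h2, h3, h4⟩ ⟨h1', h2', h3', h4'⟩
    apply hne
    subst h1
    subst h1'
    have : n = n' := by
      have a : ((k : ℤ) + l + 1) * (n - n') < ((k : ℤ) + l + 1) * 1 := by linarith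
      have b : ((k : ℤ) + l + 1) * (n' - n) < ((k : ℤ) + l + 1) * 1 := by linarith
      have a' := lt_of_mul_lt_mul_left a (by positivity)
      have b' := lt_of_mul_lt_mul_left b (by positivity)
      omega
    rw [this]
  · ext p
    rw [hS, Set.mem_sUnion]
    have hK : (0 : ℤ) < (k : ℤ) + l + 1 := by positivity
    constructor
    · rintro ⟨P, ⟨y, n, rfl⟩, h1, h2, h3, h4⟩ ⟨c, hc⟩
      subst h1
      have a : ((k : ℤ) + l + 1) * (c - n) < ((k : ℤ) + l + 1) * 1 := by linarith
      have b : ((k : ℤ) + l + 1) * (n - c) < ((k : ℤ) + l + 1) * 1 := by linarith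
      have a' := lt_of_mul_lt_mul_left a hK.le
      have b' := lt_of_mul_lt_mul_left b hK.le
      have : c = n := by omega
      subst this
      apply h4; linarith
    · intro h
      have e := Int.emod_add_mul_ediv (p i - f (p j) + k) ((k : ℤ) + l + 1)
      have u := Int.emod_nonneg (p i - f (p j) + k) hK.ne'
      have v := Int.emod_lt_of_pos (p i - f (p j) + k) hK
      refine ⟨_, ⟨p j, (p i - f (p j) + k) / ((k : ℤ) + l + 1), rfl⟩, rfl, ?_, ?_, ?_⟩
      · linarith
      · linarith
      · intro h'
        exact h ⟨(p i - f (p j) + k) / ((k : ℤ) + l + 1), by linarith⟩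

/-- The explicit sets `A, B, C` from the proof for `k + ℓ` odd: they are pairwise
disjoint and `T = k(1)ℓ` tiles each of `ℤ² ∖ (A ∪ B)`, `ℤ² ∖ (A ∪ C)`,
`ℤ² ∖ (B ∪ C)`. -/
theorem ABC_odd_sum_partial_tilings (k l : ℕ) (hk : 0 < k) (hl : 0 < l)
    (hodd : Odd (k + l)) :
    letI K : ℤ := (k : ℤ) + l + 1
    letI A : Set (Fin 2 → ℤ) := {p | K ∣ p 0 - p 1 ∧ 2 ∣ p 0}
    letI B : Set (Fin 2 → ℤ) := {p | K ∣ p 0 - p 1 ∧ ¬ (2 ∣ p 0)}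
    letI C : Set (Fin 2 → ℤ) := {p | K ∣ p 0 - (p 1 - 1) ∧ 2 ∣ p 0}
    Disjoint A B ∧ Disjoint A C ∧ Disjoint B C ∧
    Tiles 2 (punctTile k 1 l) (Set.univ \ (A ∪ B)) ∧
    Tiles 2 (punctTile k 1 l) (Set.univ \ (A ∪ C)) ∧
    Tiles 2 (punctTile k 1 l) (Set.univ \ (B ∪ C)) := by

  have h2 : (2 : ℤ) ∣ (k : ℤ) + l + 1 := by
    obtain ⟨m, hm⟩ := hodd
    omega
  have h3 : (3 : ℤ) ≤ (k : ℤ) + l + 1 := by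
    obtain ⟨m, hm⟩ := hodd
    omega
  generalize hKd : (k : ℤ) + l + 1 = K at h2 h3 ⊢
  have hpar : ∀ a : ℤ, K ∣ a → 2 ∣ a := fun a h => h2.trans h
  refine ⟨?_, ?_, ?_, ?_, ?_, ?_⟩
  · rw [Set.disjoint_left]
    rintro p ⟨_, h⟩ ⟨_, h'⟩
    exact h' h
  · rw [Set.disjoint_left]
    rintro p ⟨h, _⟩ ⟨h', _⟩
    have := hpar _ h
    have := hpar _ h'
    omega
  · rw [Set.disjoint_left]
    rintro p ⟨_, h⟩ ⟨_, h'⟩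
    exact h h'
  · refine tiles_lines k l 0 1 (by decide) (fun y => y) _ ?_
    intro p
    rw [hKd]
    simp only [Set.mem_sdiff, Set.mem_univ, true_and, Set.mem_union, Set.mem_setOf_eq]
    tauto
  · refine tiles_lines k l 0 1 (by decide) (fun y => if 2 ∣ y then y else y - 1) _ ?_
    intro p
    rw [hKd]
    simp only [Set.mem_sdiff, Set.mem_univ, true_and, Set.mem_union, Set.mem_setOf_eq]
    have q1 := hpar (p 0 - p 1)
    have q2 := hpar (p 0 - (p 1 - 1))
    split_ifs with h
    · have : K ∣ p 0 - p 1 → 2 ∣ p 0 := fun h => by have := q1 h; omega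
      have : K ∣ p 0 - (p 1 - 1) → ¬ 2 ∣ p 0 := fun h => by have := q2 h; omega
      tauto
    · have : K ∣ p 0 - p 1 → ¬ 2 ∣ p 0 := fun h => by have := q1 h; omega
      have : K ∣ p 0 - (p 1 - 1) → 2 ∣ p 0 := fun h => by have := q2 h; omega
      tauto
  · refine tiles_lines k l 1 0 (by decide) (fun x => if 2 ∣ x then x + 1 else x) _ ?_
    intro p
    rw [hKd]
    simp only [Set.mem_sdiff, Set.mem_univ, true_and, Set.mem_union, Set.mem_setOf_eq]
    split_ifs with h
    · have : K ∣ p 0 - (p 1 - 1) ↔ K ∣ p 1 - (p 0 + 1) := by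
        rw [← dvd_neg]; ring_nf
      tauto
    · have : K ∣ p 0 - p 1 ↔ K ∣ p 1 - p 0 := dvd_sub_comm
      tauto
end

section
/- Let k be a positive integer with k ≡ 2 (mod 4), and let T = k(1)k. Let X = {(x,y) ∈ ℤ² : x − y ≡ 0 (mod k+1)}, A = {(x,y) ∈ X : x ≡ 0 or 1 (mod 4)}, B = {(x,y) ∈ X : x ≡ 2 or 3 (mod 4)}, and C = B + (0,1) = {(x,y) ∈ ℤ² : y − x ≡ 1 (mod k+1), x ≡ 2 or 3 (mod 4)}. Then A, B, C are pairwise disjoint, and T tiles each of ℤ² ∖ (A ∪ B), ℤ² ∖ (A ∪ C), and ℤ² ∖ (B ∪ C). -/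
/-- Assemble a tiling of a subset of `ℤ²` from tilings of all lines in direction `i`. -/
lemma tiles_of_lines (T : Set ℤ) (S : Set (Fin 2 → ℤ)) (i i' : Fin 2) (hi : i' ≠ i)
    (V : ℤ → Set ℤ)
    (h1 : ∀ p : Fin 2 → ℤ, p ∈ S ↔ ∃ v ∈ V (p i'), p i - v ∈ T)
    (h2 : ∀ c x, ∀ v ∈ V c, ∀ w ∈ V c, x - v ∈ T → x - w ∈ T → v = w) :
    Tiles 2 T S := by
  have hj : ∀ j : Fin 2, j = i ∨ j = i' := by
    intro j; omega
  refine ⟨{P | ∃ c, ∃ v ∈ V c, P = (fun x : ℤ => fun j : Fin 2 =>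
    (if j = i then v else c) + if j = i then 1 * x else 0) '' T}, ?_, ?_, ?_⟩
  · rintro P ⟨c, v, hv, rfl⟩
    exact ⟨fun j => if j = i then v else c, i, 1, Or.inl rfl, rfl⟩
  · rintro P ⟨c, v, hv, rfl⟩ Q ⟨d, w, hw, rfl⟩ hne
    rw [Set.disjoint_left]
    rintro p ⟨x, hx, rfl⟩ ⟨y, hy, hxy⟩
    have e1 := congrFun hxy i
    have e2 := congrFun hxy i'
    simp [hi] at e1 e2
    subst e2
    apply hne
    have : v = w := by
      apply h2 d (v + x) v hv w hw
      · simpa using hx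
      · rw [← e1]; simpa using hy
    rw [this]
  · ext p
    rw [h1]
    constructor
    · rintro ⟨P, ⟨c, v, hv, rfl⟩, x, hx, rfl⟩
      refine ⟨v, ?_, ?_⟩
      · simpa [hi] using hv
      · simpa using hx
    · rintro ⟨v, hv, hx⟩
      refine ⟨_, ⟨p i', v, hv, rfl⟩, p i - v, hx, ?_⟩
      funext j
      rcases hj j with rfl | rfl
      · simp
      · simp [hi]

lemma div_unique (M a b r s : ℤ) (hr : 0 ≤ r) (hr' : r < M) (hs : 0 ≤ s) (hs' : s < M)
    (h : M * a + r = M * b + s) : a = b := by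
  have hM : 0 < M := by omega
  by_contra hne
  rcases lt_or_gt_of_ne hne with h' | h'
  · nlinarith [mul_le_mul_of_nonneg_left (show a + 1 ≤ b by omega) hM.le]
  · nlinarith [mul_le_mul_of_nonneg_left (show b + 1 ≤ a by omega) hM.le]

lemma mem_T (k : ℕ) (x : ℤ) : x ∈ punctTile k 1 k ↔
    (0 ≤ x ∧ x < (k : ℤ)) ∨ ((k : ℤ) + 1 ≤ x ∧ x < 2 * (k : ℤ) + 1) := by
  simp only [punctTile, Set.mem_ofPred_eq]
  push_cast
  constructor <;> intro h <;> omega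

/-- Period decomposition. -/
lemma decomp (M : ℤ) (hM : 0 < M) (p : ℤ) : ∃ a r, 0 ≤ r ∧ r < M ∧ p = M * a + r :=
  ⟨p / M, p % M, Int.emod_nonneg _ hM.ne', Int.emod_lt_of_pos _ hM,
    (Int.mul_ediv_add_emod p M).symm⟩

/-- A multiple of `n` in `[0, 4n]`. -/
lemma dvd_cases (n r : ℤ) (hn : 0 < n) (h0 : 0 ≤ r) (h4 : r ≤ 4 * n) :
    n ∣ r ↔ r = 0 ∨ r = n ∨ r = 2 * n ∨ r = 3 * n ∨ r = 4 * n := by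
  constructor
  · rintro ⟨q, rfl⟩
    have : 0 ≤ q := by by_contra hq; nlinarith [show q + 1 ≤ 0 by omega]
    have : q ≤ 4 := by by_contra hq; nlinarith [show 5 ≤ q by omega]
    interval_cases q <;> omega
  · rintro (rfl | rfl | rfl | rfl | rfl)
    exacts [dvd_zero _, dvd_rfl, dvd_mul_left _ _, dvd_mul_left _ _, dvd_mul_left _ _]

/-- The line missing one residue class mod `k+1`. -/
lemma line_one (k : ℕ) (c x : ℤ) :
    ¬ ((k : ℤ) + 1 ∣ x - c) ↔
      ∃ v ∈ {v : ℤ | ∃ a, v = c + 2 * ((k : ℤ) + 1) * a + 1}, x - v ∈ punctTile k 1 k := by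
  simp only [mem_T, Set.mem_ofPred_eq]
  obtain ⟨a, r, h0, h1, hp⟩ := decomp (2 * ((k : ℤ) + 1)) (by omega) (x - c)
  have hd : ((k : ℤ) + 1 ∣ x - c) ↔ ((k : ℤ) + 1 ∣ r) := by
    rw [hp]; exact Int.dvd_add_right ⟨2 * a, by ring⟩
  rw [hd, dvd_cases _ _ (by omega) h0 (by omega)]
  constructor
  · intro h
    refine ⟨_, ⟨a, rfl⟩, ?_⟩
    generalize 2 * ((k : ℤ) + 1) * a = m at *
    omega
  · rintro ⟨v, ⟨b, rfl⟩, h⟩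
    have : a = b := div_unique (2 * ((k : ℤ) + 1)) a b r
      (x - c - 2 * ((k : ℤ) + 1) * b) h0 h1 (by omega) (by omega) (by omega)
    subst this
    generalize 2 * ((k : ℤ) + 1) * a = m at *
    omega

lemma line_one_uniq (k : ℕ) (c x : ℤ) :
    ∀ v ∈ {v : ℤ | ∃ a, v = c + 2 * ((k : ℤ) + 1) * a + 1},
    ∀ w ∈ {v : ℤ | ∃ a, v = c + 2 * ((k : ℤ) + 1) * a + 1},
    x - v ∈ punctTile k 1 k → x - w ∈ punctTile k 1 k → v = w := by
  simp only [mem_T, Set.mem_ofPred_eq]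
  rintro _ ⟨a, rfl⟩ _ ⟨b, rfl⟩ h h'
  have : a = b := div_unique (2 * ((k : ℤ) + 1)) a b
      (x - c - 2 * ((k : ℤ) + 1) * a)
      (x - c - 2 * ((k : ℤ) + 1) * b) (by omega) (by omega) (by omega) (by omega) (by omega)
  rw [this]

/-- Anchors for the rows of the complement of `B ∪ C`. -/
def anchors (k : ℕ) (y : ℤ) : Set ℤ :=
  {v | ∃ a, v = y + (y - 3) * ((k : ℤ) + 1) + 4 * ((k : ℤ) + 1) * a + 1 ∨
    v = y + (y - 3) * ((k : ℤ) + 1) + 4 * ((k : ℤ) + 1) * a + 2 * ((k : ℤ) + 1)}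

lemma line_two (k : ℕ) (hk : k % 4 = 2) (y x : ℤ) :
    ¬ (((k : ℤ) + 1 ∣ x - y ∧ (x % 4 = 2 ∨ x % 4 = 3)) ∨
      ((k : ℤ) + 1 ∣ y - x - 1 ∧ (x % 4 = 2 ∨ x % 4 = 3))) ↔
      ∃ v ∈ anchors k y, x - v ∈ punctTile k 1 k := by
  simp only [mem_T, anchors, Set.mem_ofPred_eq]
  obtain ⟨a, r, h0, h1, hp⟩ := decomp (4 * ((k : ℤ) + 1)) (by omega)
    (x - (y + (y - 3) * ((k : ℤ) + 1)))
  have hd : ((k : ℤ) + 1 ∣ x - y) ↔ ((k : ℤ) + 1 ∣ r) := by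
    rw [show x - y = ((k : ℤ) + 1) * (4 * a + (y - 3)) + r by linear_combination hp]
    exact Int.dvd_add_right ⟨_, rfl⟩
  have hd' : ((k : ℤ) + 1 ∣ y - x - 1) ↔ ((k : ℤ) + 1 ∣ r + 1) := by
    rw [← dvd_neg, show -(y - x - 1) = ((k : ℤ) + 1) * (4 * a + (y - 3)) + (r + 1) by
      linear_combination hp]
    exact Int.dvd_add_right ⟨_, rfl⟩
  have hx : x % 4 = (r + 3) % 4 := by
    obtain ⟨q, hq⟩ : ∃ q : ℤ, (k : ℤ) = 4 * q + 2 := ⟨k / 4, by omega⟩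
    have : x = r + 3 + 4 * (((k : ℤ) + 1) * a + y + (y - 3) * q - 3) := by
      rw [hq] at hp ⊢; linear_combination hp
    omega
  rw [hd, hd', dvd_cases _ _ (by omega) h0 (by omega),
    dvd_cases _ (r + 1) (by omega) (by omega) (by omega), hx]
  clear hd hd' hx
  generalize y + (y - 3) * ((k : ℤ) + 1) = c at *
  constructor
  · intro h
    by_cases hr : r < 2 * ((k : ℤ) + 1)
    · refine ⟨_, ⟨a, Or.inl rfl⟩, ?_⟩
      generalize 4 * ((k : ℤ) + 1) * a = m at *
      omega
    · refine ⟨_, ⟨a, Or.inr rfl⟩, ?_⟩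
      generalize 4 * ((k : ℤ) + 1) * a = m at *
      omega
  · rintro ⟨v, ⟨b, hv⟩, h⟩
    have : a = b := div_unique (4 * ((k : ℤ) + 1)) a b r
      (x - c - 4 * ((k : ℤ) + 1) * b) h0 h1 (by omega) (by omega) (by omega)
    subst this
    generalize 4 * ((k : ℤ) + 1) * a = m at *
    omega

lemma line_two_uniq (k : ℕ) (y x : ℤ) :
    ∀ v ∈ anchors k y, ∀ w ∈ anchors k y,
    x - v ∈ punctTile k 1 k → x - w ∈ punctTile k 1 k → v = w := by
  simp only [mem_T, anchors, Set.mem_ofPred_eq]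
  rintro v ⟨a, hv⟩ w ⟨b, hw⟩ h h'
  generalize y + (y - 3) * ((k : ℤ) + 1) = c at *
  have : a = b := div_unique (4 * ((k : ℤ) + 1)) a b
      (x - c - 4 * ((k : ℤ) + 1) * a)
      (x - c - 4 * ((k : ℤ) + 1) * b) (by omega) (by omega) (by omega) (by omega) (by omega)
  subst this
  generalize 4 * ((k : ℤ) + 1) * a = m at *
  omega

/-- The explicit sets `A, B, C` from the proof for `k ≡ 2 (mod 4)`: they are
pairwise disjoint and `T = k(1)k` tiles each of `ℤ² ∖ (A ∪ B)`,
`ℤ² ∖ (A ∪ C)`, `ℤ² ∖ (B ∪ C)`. -/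
theorem ABC_two_mod_four_partial_tilings (k : ℕ) (hk : 0 < k) (h : k % 4 = 2) :
    letI X : Set (Fin 2 → ℤ) := {p | ((k : ℤ) + 1) ∣ p 0 - p 1}
    letI A : Set (Fin 2 → ℤ) := {p | p ∈ X ∧ (p 0 % 4 = 0 ∨ p 0 % 4 = 1)}
    letI B : Set (Fin 2 → ℤ) := {p | p ∈ X ∧ (p 0 % 4 = 2 ∨ p 0 % 4 = 3)}
    letI C : Set (Fin 2 → ℤ) :=
      {p | ((k : ℤ) + 1) ∣ p 1 - p 0 - 1 ∧ (p 0 % 4 = 2 ∨ p 0 % 4 = 3)}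
    Disjoint A B ∧ Disjoint A C ∧ Disjoint B C ∧
    Tiles 2 (punctTile k 1 k) (Set.univ \ (A ∪ B)) ∧
    Tiles 2 (punctTile k 1 k) (Set.univ \ (A ∪ C)) ∧
    Tiles 2 (punctTile k 1 k) (Set.univ \ (B ∪ C)) := by
  have hnd : ∀ t : ℤ, (k : ℤ) + 1 ∣ t → (k : ℤ) + 1 ∣ -t - 1 → False := by
    intro t h1 h2
    have h3 : (k : ℤ) + 1 ∣ 1 := by
      have := dvd_neg.mpr (dvd_add h1 h2)
      simpa using this
    have := Int.le_of_dvd (by norm_num) h3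
    omega
  refine ⟨?_, ?_, ?_, ?_, ?_, ?_⟩
  · rw [Set.disjoint_left]
    rintro p ⟨_, h1⟩ ⟨_, h2⟩
    omega
  · rw [Set.disjoint_left]
    rintro p ⟨_, h1⟩ ⟨_, h2⟩
    omega
  · rw [Set.disjoint_left]
    rintro p ⟨h1, _⟩ ⟨h2, _⟩
    exact hnd _ h1 (by rwa [neg_sub])
  · refine tiles_of_lines _ _ 0 1 (by decide) _ (fun p => ?_) (fun c x => line_one_uniq k c x)
    rw [← line_one]
    simp only [Set.mem_sdiff, Set.mem_univ, true_and, Set.mem_union, Set.mem_ofPred_eq]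
    have : p 0 % 4 = 0 ∨ p 0 % 4 = 1 ∨ p 0 % 4 = 2 ∨ p 0 % 4 = 3 := by omega
    tauto
  · refine tiles_of_lines _ _ 1 0 (by decide) _ (fun p => ?_)
      (fun c x => line_one_uniq k (if c % 4 = 0 ∨ c % 4 = 1 then c else c + 1) x)
    rw [← line_one]
    simp only [Set.mem_sdiff, Set.mem_univ, true_and, Set.mem_union, Set.mem_ofPred_eq]
    rw [dvd_sub_comm]
    split_ifs with h4
    · have : ¬ (p 0 % 4 = 2 ∨ p 0 % 4 = 3) := by omega
      tauto
    · have : (p 0 % 4 = 2 ∨ p 0 % 4 = 3) := by omega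
      rw [← sub_sub]
      tauto
  · refine tiles_of_lines _ _ 0 1 (by decide) _ (fun p => ?_) (fun c x => line_two_uniq k c x)
    rw [← line_two k h]
    simp only [Set.mem_sdiff, Set.mem_univ, true_and, Set.mem_union, Set.mem_ofPred_eq]
end

section
/- Let k and ℓ be positive integers with v₂(k) = v₂(ℓ) ≥ 1, and let T = k(1)ℓ. Then there exist pairwise disjoint subsets A, B, C of ℤ² of the same cardinality (i.e., with bijections A → B and A → C) such that T tiles each of ℤ² ∖ (A ∪ B), ℤ² ∖ (A ∪ C), and ℤ² ∖ (B ∪ C). -/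
/-- Tiling a set line by line, where each line is cut into blocks of length `L`
and each block contains one copy of the tile. -/
theorem tiles_lines_s17 (k l : ℕ) (c d : Fin 2) (hcd : c ≠ d) (L : ℤ)
    (a : ℤ → ℤ) (v h : ℤ → ℤ → ℤ) (hL : 0 < L)
    (hv1 : ∀ y i, a y + i * L ≤ v y i)
    (hv2 : ∀ y i, v y i + (k + l + 1) ≤ a y + i * L + L)
    (hh : ∀ y i, h y i = v y i + k ∨ h y i = v y i + l)
    (S : Set (Fin 2 → ℤ))
    (hS : ∀ p, p ∈ S ↔ ∃ i, v (p d) i ≤ p c ∧ p c < v (p d) i + (k + l + 1) ∧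
      p c ≠ h (p d) i) : Tiles 2 (punctTile k 1 l) S := by
  have hcov : ∀ j : Fin 2, j = c ∨ j = d := by
    intro j; fin_cases c <;> fin_cases d <;> fin_cases j <;> simp_all
  refine ⟨Set.range (fun q : ℤ × ℤ => {p : Fin 2 → ℤ | p d = q.1 ∧ v q.1 q.2 ≤ p c ∧
    p c < v q.1 q.2 + (k + l + 1) ∧ p c ≠ h q.1 q.2}), ?_, ?_, ?_⟩
  · rintro P ⟨⟨y, i⟩, rfl⟩
    rcases hh y i with h1 | h1
    · refine ⟨fun j => if j = c then v y i else y, c, 1, Or.inl rfl, ?_⟩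
      ext p
      simp only [Set.mem_setOf_eq, Set.mem_image, punctTile]
      constructor
      · rintro ⟨e1, e2, e3, e4⟩
        refine ⟨p c - v y i, ?_, ?_⟩
        · push_cast; omega
        · funext j
          rcases hcov j with rfl | rfl
          · simp
          · simp [hcd.symm, e1]
      · rintro ⟨x, hx, rfl⟩
        simp only [hcd.symm, if_true, if_false]
        push_cast at hx
        omega
    · refine ⟨fun j => if j = c then v y i + k + l else y, c, -1, Or.inr rfl, ?_⟩
      ext p
      simp only [Set.mem_setOf_eq, Set.mem_image, punctTile]
      constructor
      · rintro ⟨e1, e2, e3, e4⟩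
        refine ⟨v y i + k + l - p c, ?_, ?_⟩
        · push_cast; omega
        · funext j
          rcases hcov j with rfl | rfl
          · simp
          · simp [hcd.symm, e1]
      · rintro ⟨x, hx, rfl⟩
        simp only [hcd.symm, if_true, if_false]
        push_cast at hx
        omega
  · rintro _ ⟨⟨y, i⟩, rfl⟩ _ ⟨⟨y', i'⟩, rfl⟩ hne
    rw [Set.disjoint_left]
    rintro p ⟨e1, e2, e3, e4⟩ ⟨f1, f2, f3, f4⟩
    apply hne
    simp only at e1 e2 e3 e4 f1 f2 f3 f4
    have hy : y = y' := by rw [← e1, f1]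
    subst hy
    have a1 := hv1 y i
    have a2 := hv2 y i
    have b1 := hv1 y i'
    have b2 := hv2 y i'
    have hi : i = i' := by
      rcases lt_trichotomy i i' with hlt | heq | hlt
      · nlinarith
      · exact heq
      · nlinarith
    rw [hi]
  · ext p
    rw [hS]
    simp only [Set.sUnion_range, Set.mem_iUnion, Set.mem_setOf_eq, Prod.exists]
    constructor
    · rintro ⟨y, i, rfl, h2⟩
      exact ⟨i, h2⟩
    · rintro ⟨i, h2⟩
      exact ⟨_, i, rfl, h2⟩

/-- Each line is cut into blocks of length `k+l+1`, each with exactly one hole. -/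
theorem tiles_one (k l : ℕ) (c d : Fin 2) (hcd : c ≠ d)
    (a : ℤ → ℤ) (h : ℤ → ℤ → ℤ)
    (hh : ∀ y i, h y i = a y + i * (k + l + 1) + k ∨ h y i = a y + i * (k + l + 1) + l)
    (X : Set (Fin 2 → ℤ))
    (hX : ∀ p, p ∈ X ↔ ∃ i, p c = h (p d) i) :
    Tiles 2 (punctTile k 1 l) (Set.univ \ X) := by
  have hn : (0 : ℤ) < k + l + 1 := by positivity
  refine tiles_lines_s17 k l c d hcd (k + l + 1) a (fun y i => a y + i * (k + l + 1)) h hn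
    (fun y i => le_rfl) (fun y i => le_rfl) hh _ ?_
  intro p
  simp only [Set.mem_diff, Set.mem_univ, true_and, hX, not_exists]
  constructor
  · intro hp
    refine ⟨(p c - a (p d)) / (k + l + 1), ?_, ?_, hp _⟩
    · have := Int.ediv_mul_le (p c - a (p d)) hn.ne'
      linarith
    · have := Int.lt_ediv_add_one_mul_self (p c - a (p d)) hn
      linarith
  · rintro ⟨i, h1, h2, h3⟩ j hj
    have hij : i = j := by
      have h4 := hh (p d) j
      rw [← hj] at h4
      rcases lt_trichotomy i j with hlt | heq | hlt
      · rcases h4 with h4 | h4 <;> nlinarith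
      · exact heq
      · rcases h4 with h4 | h4 <;> nlinarith
    subst hij
    exact h3 hj

/-- Each line is cut into blocks of length `2k+2`, each with two holes. -/
theorem tiles_two (k : ℕ) (c d : Fin 2) (hcd : c ≠ d)
    (a : ℤ → ℤ) (g : ℤ → ℤ → Prop)
    (X : Set (Fin 2 → ℤ))
    (hX : ∀ p, p ∈ X ↔ ∃ i,
      (g (p d) i ∧ (p c = a (p d) + i * (2 * k + 2) ∨ p c = a (p d) + i * (2 * k + 2) + k + 1)) ∨
      (¬ g (p d) i ∧ (p c = a (p d) + i * (2 * k + 2) + k ∨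
        p c = a (p d) + i * (2 * k + 2) + 2 * k + 1))) :
    Tiles 2 (punctTile k 1 k) (Set.univ \ X) := by
  classical
  have hn : (0 : ℤ) < 2 * k + 2 := by positivity
  refine tiles_lines_s17 k k c d hcd (2 * k + 2) a
    (fun y i => a y + i * (2 * k + 2) + if g y i then 1 else 0)
    (fun y i => a y + i * (2 * k + 2) + (if g y i then 1 else 0) + k) hn
    (fun y i => by split_ifs <;> omega)
    (fun y i => by split_ifs <;> omega) (fun y i => Or.inl rfl) _ ?_
  intro p
  simp only [Set.mem_diff, Set.mem_univ, true_and, hX, not_exists]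
  constructor
  · intro hp
    have h1 := Int.ediv_mul_le (p c - a (p d)) hn.ne'
    have h2 := Int.lt_ediv_add_one_mul_self (p c - a (p d)) hn
    have h3 := hp ((p c - a (p d)) / (2 * k + 2))
    refine ⟨(p c - a (p d)) / (2 * k + 2), ?_⟩
    generalize (p c - a (p d)) / (2 * (k : ℤ) + 2) = i at *
    rw [add_mul] at h2
    generalize i * (2 * (k : ℤ) + 2) = w at *
    by_cases hg : g (p d) i
    · simp only [hg, true_and, not_true, false_and, or_false, if_true] at h3 ⊢
      omega
    · simp only [hg, not_false_eq_true, true_and, false_and, false_or, if_false] at h3 ⊢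
      omega
  · rintro ⟨i, h1, h2, h3⟩ j hj
    have b1 : a (p d) + j * (2 * k + 2) ≤ p c := by
      rcases hj with ⟨_, h | h⟩ | ⟨_, h | h⟩ <;> omega
    have b2 : p c < a (p d) + j * (2 * k + 2) + (2 * k + 2) := by
      rcases hj with ⟨_, h | h⟩ | ⟨_, h | h⟩ <;> omega
    have b3 : a (p d) + i * (2 * k + 2) ≤ p c := by
      split_ifs at h1 <;> omega
    have b4 : p c < a (p d) + i * (2 * k + 2) + (2 * k + 2) := by
      split_ifs at h2 <;> omega
    have hij : i = j := by
      rcases lt_trichotomy i j with hlt | heq | hlt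
      · nlinarith
      · exact heq
      · nlinarith
    subst hij
    by_cases hg : g (p d) i
    · simp only [hg, true_and, not_true, false_and, or_false, if_true] at *
      omega
    · simp only [hg, not_false_eq_true, true_and, false_and, false_or, if_false] at *
      omega

theorem infinite_of_inj (A : Set (Fin 2 → ℤ)) (g : ℤ → Fin 2 → ℤ)
    (hg : Function.Injective g) (hA : ∀ m, g m ∈ A) : Infinite A :=
  Infinite.of_injective (fun m => (⟨g m, hA m⟩ : A))
    (fun a b hab => hg (congrArg Subtype.val hab))

/-- An antiperiodic colouring of the integers. -/
theorem flip_colour (e z : ℤ) (he : e ≠ 0) : ((z + e) / e) % 2 = 1 ↔ ¬ (z / e) % 2 = 1 := by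
  have : (z + e) / e = z / e + 1 := by
    rw [Int.add_ediv_of_dvd_right (dvd_refl e), Int.ediv_self he]
  rw [this]; omega

theorem case_ne (k l : ℕ) (hkl : k ≠ l) :
    ∃ A B C : Set (Fin 2 → ℤ),
      Disjoint A B ∧ Disjoint A C ∧ Disjoint B C ∧
      Nonempty (A ≃ B) ∧ Nonempty (A ≃ C) ∧
      Tiles 2 (punctTile k 1 l) (Set.univ \ (A ∪ B)) ∧
      Tiles 2 (punctTile k 1 l) (Set.univ \ (A ∪ C)) ∧
      Tiles 2 (punctTile k 1 l) (Set.univ \ (B ∪ C)) := by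
  classical
  obtain ⟨e, he⟩ : ∃ e : ℤ, e = l - k := ⟨_, rfl⟩
  have he0 : e ≠ 0 := by omega
  obtain ⟨n, hn⟩ : ∃ n : ℤ, n = k + l + 1 := ⟨_, rfl⟩
  have hn0 : n ≠ 0 := by omega
  obtain ⟨f, hf⟩ : ∃ f : ℤ → Prop, f = fun z => (z / e) % 2 = 1 := ⟨_, rfl⟩
  have hflip : ∀ z, f (z + e) ↔ ¬ f z := fun z => by rw [hf]; exact flip_colour e z he0
  have hf0 : ¬ f 0 := by rw [hf]; simp
  have hf1 : f e := by have := (hflip 0).2 hf0; simpa using this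
  have hned : ∀ i j : ℤ, i * n ≠ e + j * n := by
    intro i j hij
    have : (i - j) * n = e := by linarith
    have h1 : n ∣ e := ⟨i - j, by linarith⟩
    have := Int.le_of_dvd (abs_pos.2 he0) ((dvd_abs _ _).2 h1)
    rcases abs_cases e with ⟨h, _⟩ | ⟨h, _⟩ <;> omega
  let A : Set (Fin 2 → ℤ) := {p | f (p 0) ∧ ∃ i, p 1 = p 0 + i * n}
  let B : Set (Fin 2 → ℤ) := {p | f (p 0) ∧ ∃ i, p 1 = p 0 + i * n + e}
  let C : Set (Fin 2 → ℤ) := {p | ¬ f (p 0) ∧ ∃ i, p 1 = p 0 + i * n}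
  have iA : Infinite A := infinite_of_inj A (fun m => ![e, e + m * n])
    (fun a b hab => by simpa [hn0] using congrFun hab 1) (fun m => ⟨by simpa using hf1, m, by simp⟩)
  have iB : Infinite B := infinite_of_inj B (fun m => ![e, e + m * n + e])
    (fun a b hab => by simpa [hn0] using congrFun hab 1) (fun m => ⟨by simpa using hf1, m, by simp⟩)
  have iC : Infinite C := infinite_of_inj C (fun m => ![0, 0 + m * n])
    (fun a b hab => by simpa [hn0] using congrFun hab 1) (fun m => ⟨by simpa using hf0, m, by simp⟩)
  refine ⟨A, B, C, ?_, ?_, ?_, nonempty_equiv_of_countable, nonempty_equiv_of_countable,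
    ?_, ?_, ?_⟩
  · rw [Set.disjoint_left]
    rintro p ⟨_, i, h1⟩ ⟨_, j, h2⟩
    exact hned i j (by linarith)
  · rw [Set.disjoint_left]
    rintro p ⟨h1, _⟩ ⟨h2, _⟩
    exact h2 h1
  · rw [Set.disjoint_left]
    rintro p ⟨h1, _⟩ ⟨h2, _⟩
    exact h2 h1
  · refine tiles_one k l 0 1 (by decide) (fun y => y - l)
      (fun y i => if f (y + i * n) then y + i * n else y + i * n - e) ?_ _ ?_
    · intro y i
      rw [← hn]
      split_ifs
      · right; ring
      · left; rw [he]; ring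
    · intro p
      constructor
      · rintro (⟨h1, i, h2⟩ | ⟨h1, i, h2⟩)
        · refine ⟨-i, ?_⟩
          have : p 1 + -i * n = p 0 := by rw [h2]; ring
          rw [this, if_pos h1]
        · refine ⟨-i, ?_⟩
          have : p 1 + -i * n = p 0 + e := by rw [h2]; ring
          rw [this, if_neg (by rw [hflip]; exact not_not.2 h1)]
          ring
      · rintro ⟨i, hi⟩
        split_ifs at hi with h
        · exact Or.inl ⟨hi ▸ h, -i, by rw [hi]; ring⟩
        · refine Or.inr ⟨?_, -i, by rw [hi]; ring⟩
          have : p 1 + i * n = p 0 + e := by rw [hi]; ring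
          rw [this, hflip, not_not] at h
          exact h
  · refine tiles_one k l 1 0 (by decide) (fun x => x - k)
      (fun x i => x + i * n) ?_ _ ?_
    · intro y i
      rw [← hn]
      left; ring
    · intro p
      constructor
      · rintro (⟨h1, i, h2⟩ | ⟨h1, i, h2⟩)
        · exact ⟨i, h2⟩
        · exact ⟨i, h2⟩
      · rintro ⟨i, hi⟩
        by_cases h : f (p 0)
        · exact Or.inl ⟨h, i, hi⟩
        · exact Or.inr ⟨h, i, hi⟩
  · refine tiles_one k l 1 0 (by decide) (fun x => x - k)
      (fun x i => if f x then x + i * n + e else x + i * n) ?_ _ ?_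
    · intro y i
      rw [← hn]
      split_ifs
      · right; rw [he]; ring
      · left; ring
    · intro p
      constructor
      · rintro (⟨h1, i, h2⟩ | ⟨h1, i, h2⟩)
        · exact ⟨i, by rw [if_pos h1, h2]⟩
        · exact ⟨i, by rw [if_neg h1, h2]⟩
      · rintro ⟨i, hi⟩
        split_ifs at hi with h
        · exact Or.inl ⟨h, i, hi⟩
        · exact Or.inr ⟨h, i, hi⟩

theorem case_eq (k : ℕ) (hk : 0 < k) :
    ∃ A B C : Set (Fin 2 → ℤ),
      Disjoint A B ∧ Disjoint A C ∧ Disjoint B C ∧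
      Nonempty (A ≃ B) ∧ Nonempty (A ≃ C) ∧
      Tiles 2 (punctTile k 1 k) (Set.univ \ (A ∪ B)) ∧
      Tiles 2 (punctTile k 1 k) (Set.univ \ (A ∪ C)) ∧
      Tiles 2 (punctTile k 1 k) (Set.univ \ (B ∪ C)) := by
  classical
  have hk0 : (k : ℤ) ≠ 0 := by omega
  obtain ⟨f, hf⟩ : ∃ f : ℤ → Prop, f = fun z => (z / (k : ℤ)) % 2 = 1 := ⟨_, rfl⟩
  have hflip : ∀ z, f (z + k) ↔ ¬ f z := fun z => by rw [hf]; exact flip_colour k z hk0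
  have hf0 : ∀ m : ℤ, ¬ f (2 * m * k) := by
    intro m; rw [hf]; simp only [Int.mul_ediv_cancel _ hk0]; omega
  have hf1 : ∀ m : ℤ, f (2 * m * k + k) := fun m => (hflip _).2 (hf0 m)
  let A : Set (Fin 2 → ℤ) := {p | ∃ i : ℤ, f (p 0 + i * (k + 1)) ∧
    (p 1 = p 0 + i * (2 * k + 2) + k ∨ p 1 = p 0 + i * (2 * k + 2) + 2 * k + 1)}
  let B : Set (Fin 2 → ℤ) := {p | ∃ i : ℤ, f (p 0 + i * (k + 1)) ∧
    (p 1 = p 0 + i * (2 * k + 2) ∨ p 1 = p 0 + i * (2 * k + 2) + k + 1)}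
  let C : Set (Fin 2 → ℤ) := {p | ∃ i : ℤ, ¬ f (p 0 + i * (k + 1)) ∧
    (p 1 = p 0 + i * (2 * k + 2) ∨ p 1 = p 0 + i * (2 * k + 2) + k + 1)}
  have iA : Infinite A := infinite_of_inj A (fun m => ![2 * m * k + k, 2 * m * k + k + k])
    (fun a b hab => by simpa [hk.ne'] using congrFun hab 0)
    (fun m => ⟨0, by simpa using hf1 m, by simp⟩)
  have iB : Infinite B := infinite_of_inj B (fun m => ![2 * m * k + k, 2 * m * k + k])
    (fun a b hab => by simpa [hk.ne'] using congrFun hab 0)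
    (fun m => ⟨0, by simpa using hf1 m, by simp⟩)
  have iC : Infinite C := infinite_of_inj C (fun m => ![2 * m * k, 2 * m * k])
    (fun a b hab => by simpa [hk.ne'] using congrFun hab 0)
    (fun m => ⟨0, by simpa using hf0 m, by simp⟩)
  have key : ∀ i j r : ℤ, -(k + 1 : ℤ) < r → r < k + 1 → r ≠ 0 →
      i * (k + 1) ≠ j * (k + 1) + r := by
    intro i j r h1 h2 h3 hij
    have h4 : (k + 1 : ℤ) ∣ r := ⟨i - j, by linarith⟩
    have := Int.le_of_dvd (abs_pos.2 h3) ((dvd_abs _ _).2 h4)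
    rcases abs_cases r with ⟨h, _⟩ | ⟨h, _⟩ <;> omega
  have hAB : ∀ x y i j : ℤ,
      (y = x + i * (2 * k + 2) + k ∨ y = x + i * (2 * k + 2) + 2 * k + 1) →
      (y = x + j * (2 * k + 2) ∨ y = x + j * (2 * k + 2) + k + 1) → False := by
    rintro x y i j (h1 | h1) (h2 | h2)
    · exact key (2 * j) (2 * i) k (by omega) (by omega) hk0 (by linarith)
    · exact key (2 * j + 1) (2 * i) k (by omega) (by omega) hk0 (by linarith)
    · exact key (2 * j) (2 * i + 1) k (by omega) (by omega) hk0 (by linarith)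
    · exact key (2 * j + 1) (2 * i + 1) k (by omega) (by omega) hk0 (by linarith)
  refine ⟨A, B, C, ?_, ?_, ?_, nonempty_equiv_of_countable, nonempty_equiv_of_countable,
    ?_, ?_, ?_⟩
  · rw [Set.disjoint_left]
    rintro p ⟨i, _, h1⟩ ⟨j, _, h2⟩
    exact hAB _ _ _ _ h1 h2
  · rw [Set.disjoint_left]
    rintro p ⟨i, _, h1⟩ ⟨j, _, h2⟩
    exact hAB _ _ _ _ h1 h2
  · rw [Set.disjoint_left]
    rintro p ⟨i, e1, h1⟩ ⟨j, e2, h2⟩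
    have hij : i = j := by
      have hpos : (0 : ℤ) < k := by omega
      rcases lt_trichotomy i j with hlt | heq | hlt
      · rcases h1 with h1 | h1 <;> rcases h2 with h2 | h2 <;> nlinarith
      · exact heq
      · rcases h1 with h1 | h1 <;> rcases h2 with h2 | h2 <;> nlinarith
    subst hij
    exact e2 e1
  · refine tiles_two k 0 1 (by decide) (fun y => y - k)
      (fun y i => f (y - k + i * (k + 1))) _ ?_
    intro p
    constructor
    · rintro (⟨i, h1, h2 | h2⟩ | ⟨i, h1, h2 | h2⟩)
      · refine ⟨-i, Or.inl ⟨?_, Or.inl ?_⟩⟩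
        · convert h1 using 1; rw [h2]; ring
        · rw [h2]; ring
      · refine ⟨-i - 1, Or.inl ⟨?_, Or.inr ?_⟩⟩
        · convert h1 using 1; rw [h2]; ring
        · rw [h2]; ring
      · refine ⟨-i, Or.inr ⟨?_, Or.inl ?_⟩⟩
        · rw [← hflip]; convert h1 using 1; rw [h2]; ring
        · rw [h2]; ring
      · refine ⟨-i - 1, Or.inr ⟨?_, Or.inr ?_⟩⟩
        · rw [← hflip]; convert h1 using 1; rw [h2]; ring
        · rw [h2]; ring
    · rintro ⟨i, ⟨h1, h2 | h2⟩ | ⟨h1, h2 | h2⟩⟩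
      · refine Or.inl ⟨-i, ?_, Or.inl ?_⟩
        · convert h1 using 1; rw [h2]; ring
        · rw [h2]; ring
      · refine Or.inl ⟨-i - 1, ?_, Or.inr ?_⟩
        · convert h1 using 1; rw [h2]; ring
        · rw [h2]; ring
      · refine Or.inr ⟨-i, ?_, Or.inl ?_⟩
        · rw [← hflip] at h1; convert h1 using 1; rw [h2]; ring
        · rw [h2]; ring
      · refine Or.inr ⟨-i - 1, ?_, Or.inr ?_⟩
        · rw [← hflip] at h1; convert h1 using 1; rw [h2]; ring
        · rw [h2]; ring
  · refine tiles_two k 1 0 (by decide) (fun x => x)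
      (fun x i => ¬ f (x + i * (k + 1))) _ ?_
    intro p
    constructor
    · rintro (⟨i, h1, h2⟩ | ⟨i, h1, h2⟩)
      · exact ⟨i, Or.inr ⟨not_not.2 h1, h2⟩⟩
      · exact ⟨i, Or.inl ⟨h1, h2⟩⟩
    · rintro ⟨i, ⟨h1, h2⟩ | ⟨h1, h2⟩⟩
      · exact Or.inr ⟨i, h1, h2⟩
      · exact Or.inl ⟨i, not_not.1 h1, h2⟩
  · refine tiles_two k 1 0 (by decide) (fun x => x) (fun x i => True) _ ?_
    intro p
    constructor
    · rintro (⟨i, h1, h2⟩ | ⟨i, h1, h2⟩)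
      · exact ⟨i, Or.inl ⟨trivial, h2⟩⟩
      · exact ⟨i, Or.inl ⟨trivial, h2⟩⟩
    · rintro ⟨i, ⟨_, h2⟩ | ⟨h1, h2⟩⟩
      · by_cases h : f (p 0 + i * (k + 1))
        · exact Or.inl ⟨i, h, h2⟩
        · exact Or.inr ⟨i, h, h2⟩
      · exact absurd trivial h1

/-- If `v₂(k) = v₂(ℓ) ≥ 1`, then there are pairwise disjoint, equinumerous sets
`A, B, C ⊆ ℤ²` such that `T = k(1)ℓ` tiles each of `ℤ² ∖ (A ∪ B)`,
`ℤ² ∖ (A ∪ C)`, `ℤ² ∖ (B ∪ C)`. -/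
theorem exists_ABC_equal_valuation (k l : ℕ) (hk : 0 < k) (hl : 0 < l)
    (hv : padicValNat 2 k = padicValNat 2 l) (hv1 : 1 ≤ padicValNat 2 k) :
    ∃ A B C : Set (Fin 2 → ℤ),
      Disjoint A B ∧ Disjoint A C ∧ Disjoint B C ∧
      Nonempty (A ≃ B) ∧ Nonempty (A ≃ C) ∧
      Tiles 2 (punctTile k 1 l) (Set.univ \ (A ∪ B)) ∧
      Tiles 2 (punctTile k 1 l) (Set.univ \ (A ∪ C)) ∧
      Tiles 2 (punctTile k 1 l) (Set.univ \ (B ∪ C)) := by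
  by_cases hkl : k = l
  · subst hkl; exact case_eq k hk
  · exact case_ne k l hkl
end

section
/- For all positive integers K and j, there exists a permutation a₁, a₂, …, a_K of {1, 2, …, K} such that for every index i with 2 ≤ i ≤ K, the difference a_i − a_{i−1} is congruent to j or to j+1 modulo K. -/
/-- For all positive `K, j` there is a permutation `a₁, …, a_K` of `{1, …, K}`
with consecutive differences congruent to `j` or `j + 1` modulo `K`. -/
theorem exists_permutation_with_step_j (K j : ℕ) (hK : 0 < K) (hj : 0 < j) :
    ∃ a : ℕ → ℕ, Set.BijOn a (Set.Icc 1 K) (Set.Icc 1 K) ∧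
      ∀ i : ℕ, 2 ≤ i → i ≤ K →
        ((a i : ℤ) - a (i - 1) ≡ j [ZMOD K] ∨
         (a i : ℤ) - a (i - 1) ≡ (j : ℤ) + 1 [ZMOD K]) := by
  obtain ⟨d, hd⟩ : ∃ d, d = Nat.gcd K j := ⟨_, rfl⟩
  obtain ⟨m, hm⟩ : ∃ m, m = K / d := ⟨_, rfl⟩
  have hdK : d ∣ K := hd ▸ Nat.gcd_dvd_left K j
  have hdj : d ∣ j := hd ▸ Nat.gcd_dvd_right K j
  have hKdm : m * d = K := by rw [hm]; exact Nat.div_mul_cancel hdK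
  have hmpos : 0 < m := by
    rcases Nat.eq_zero_or_pos m with h | h
    · subst h; omega
    · exact h
  have hmaps : Set.MapsTo (fun n => ((n - 1) * j + (n - 1) / m) % K + 1)
      (Set.Icc 1 K) (Set.Icc 1 K) := by
    intro n _
    have := Nat.mod_lt ((n - 1) * j + (n - 1) / m) hK
    simp only [Set.mem_Icc]
    omega
  have key : ∀ x y, x < K → y < K → x * j + x / m ≡ y * j + y / m [MOD K] → x = y := by
    intro x y hx hy h
    have hlt : ∀ z, z < K → z / m < d := fun z hz =>
      Nat.div_lt_of_lt_mul (by rw [hKdm]; exact hz)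
    have h0 : ∀ z, z * j ≡ 0 [MOD d] := fun z =>
      (Nat.modEq_zero_iff_dvd).2 (Dvd.dvd.mul_left hdj z)
    have h1 : x / m ≡ y / m [MOD d] :=
      Nat.ModEq.add_left_cancel ((h0 x).trans (h0 y).symm) (h.of_dvd hdK)
    have h2 : x / m = y / m := h1.eq_of_lt_of_lt (hlt x hx) (hlt y hy)
    rw [h2] at h
    have h3 : x * j ≡ y * j [MOD K] := Nat.ModEq.add_right_cancel' _ h
    have h4 := Nat.ModEq.cancel_right_div_gcd hK h3
    rw [← hd, ← hm] at h4
    have h5 : x % m = y % m := h4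
    rw [← Nat.div_add_mod x m, ← Nat.div_add_mod y m, h2, h5]
  have hinj : Set.InjOn (fun n => ((n - 1) * j + (n - 1) / m) % K + 1) (Set.Icc 1 K) := by
    intro x hx y hy h
    simp only [Set.mem_Icc] at hx hy
    have h' := Nat.succ_injective h
    have := key (x - 1) (y - 1) (by omega) (by omega) h'
    omega
  refine ⟨_, ⟨hmaps, hinj, ?_⟩, ?_⟩
  · exact ((Set.finite_Icc 1 K).injOn_iff_bijOn_of_mapsTo hmaps |>.1 hinj).surjOn
  · intro i h2 _
    obtain ⟨n, rfl⟩ : ∃ n, i = n + 2 := ⟨i - 2, by omega⟩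
    have e1 : n + 2 - 1 = n + 1 := by omega
    simp only [e1, Nat.add_sub_cancel]
    have hmod : ∀ z : ℕ, ((z % K + 1 : ℕ) : ℤ) ≡ (z : ℤ) + 1 [ZMOD K] := by
      intro z
      push_cast
      exact (Int.mod_modEq _ _).add_right 1
    have hsub := (hmod ((n + 1) * j + (n + 1) / m)).sub (hmod (n * j + n / m))
    rw [Nat.succ_div] at hsub ⊢
    split_ifs at hsub ⊢ with hc
    · right
      refine hsub.trans (congrArg (· % (K : ℤ)) ?_)
      push_cast; ring
    · left
      refine hsub.trans (congrArg (· % (K : ℤ)) ?_)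
      push_cast; ring
end

section
/- Let k, ℓ, m be positive integers with m < min{k, ℓ}. If 2m divides k + ℓ + m, then the tile k(m)ℓ tiles ℤ^3. -/
/-- One-dimensional tilings, given by the position and orientation of the tile at each point. -/
def LineTiles (T S : Set ℤ) : Prop :=
  ∃ b ε : ℤ → ℤ, ∀ x ∈ S, (ε x = 1 ∨ ε x = -1) ∧ ε x * (x - b x) ∈ T ∧
    ∀ y, ε x * (y - b x) ∈ T → y ∈ S ∧ b y = b x ∧ ε y = ε x

theorem lineTiles_empty (T : Set ℤ) : LineTiles T ∅ :=
  ⟨fun _ => 0, fun _ => 0, fun x hx => absurd hx (Set.notMem_empty x)⟩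

theorem tiles_of_lines_s19 {d : ℕ} (T : Set ℤ) (dir : (Fin d → ℤ) → Fin d)
    (h : ∀ (p : Fin d → ℤ) (i : Fin d),
      LineTiles T {x | dir (Function.update p i x) = i}) : TilesZd d T := by
  classical
  have h' : ∀ S : Set ℤ, ∃ b ε : ℤ → ℤ, LineTiles T S → ∀ x ∈ S, (ε x = 1 ∨ ε x = -1) ∧
      ε x * (x - b x) ∈ T ∧
      ∀ y, ε x * (y - b x) ∈ T → y ∈ S ∧ b y = b x ∧ ε y = ε x := by
    intro S
    by_cases hS : LineTiles T S
    · obtain ⟨b, ε, hb⟩ := hS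
      exact ⟨b, ε, fun _ => hb⟩
    · exact ⟨fun _ => 0, fun _ => 0, fun hh => absurd hh hS⟩
  choose B E hBE using h'
  let S : (Fin d → ℤ) → Set ℤ := fun p => {x | dir (Function.update p (dir p) x) = dir p}
  let f : (Fin d → ℤ) → Set (Fin d → ℤ) := fun p =>
    {q | ∃ y, q = Function.update p (dir p) y ∧
      E (S p) (p (dir p)) * (y - B (S p) (p (dir p))) ∈ T}
  have hmem : ∀ p, p (dir p) ∈ S p := by
    intro p
    simp [S]
  have hkey : ∀ p q, q ∈ f p → f q = f p := by
    rintro p q ⟨y, rfl, hy⟩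
    obtain ⟨-, -, h3⟩ := hBE (S p) (h p (dir p)) _ (hmem p)
    obtain ⟨hyS, hb, he⟩ := h3 y hy
    have hd : dir (Function.update p (dir p) y) = dir p := hyS
    have hS : S (Function.update p (dir p) y) = S p := by
      simp only [S, hd, Function.update_idem]
    simp only [f, hd, hS, Function.update_idem, Function.update_self, hb, he]
  have hself : ∀ p, p ∈ f p := by
    intro p
    exact ⟨p (dir p), by simp, (hBE (S p) (h p (dir p)) _ (hmem p)).2.1⟩
  refine ⟨Set.range f, ?_, ?_, ?_⟩
  · rintro P ⟨p, rfl⟩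
    obtain ⟨h1, -, -⟩ := hBE (S p) (h p (dir p)) _ (hmem p)
    set e := E (S p) (p (dir p)) with hedef
    set b := B (S p) (p (dir p)) with hbdef
    have hee : e * e = 1 := by rcases h1 with h1 | h1 <;> rw [h1] <;> norm_num
    refine ⟨Function.update p (dir p) b, dir p, e, h1, ?_⟩
    ext q
    constructor
    · rintro ⟨y, rfl, hy⟩
      refine ⟨e * (y - b), hy, ?_⟩
      funext j
      by_cases hj : j = dir p
      · subst hj
        simp only [Function.update_self, if_true]
        linear_combination (y - b) * hee
      · simp [hj]
    · rintro ⟨x, hx, rfl⟩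
      refine ⟨b + e * x, ?_, ?_⟩
      · funext j
        by_cases hj : j = dir p
        · subst hj
          simp
        · simp [hj]
      · have : e * (b + e * x - b) = x := by linear_combination x * hee
        change e * (b + e * x - b) ∈ T
        rwa [this]
  · rintro P ⟨p, rfl⟩ Q ⟨q, rfl⟩ hne
    rw [Set.disjoint_left]
    intro r hr hr'
    exact hne ((hkey p r hr).symm.trans (hkey q r hr'))
  · ext p
    simp only [Set.mem_sUnion, Set.mem_univ, iff_true]
    exact ⟨f p, ⟨p, rfl⟩, hself p⟩

theorem divmod_of (N q r : ℤ) (h0 : 0 ≤ r) (h1 : r < N) :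
    (N * q + r) / N = q ∧ (N * q + r) % N = r := by
  have hN : N ≠ 0 := by omega
  constructor
  · rw [Int.add_comm, Int.add_mul_ediv_left _ _ hN, Int.ediv_eq_zero_of_lt h0 h1, zero_add]
  · rw [Int.add_comm, Int.add_mul_emod_self_left, Int.emod_eq_of_lt h0 h1]

theorem lineTiles_string (k l m : ℕ) (hm : 0 < m) (H : ℤ) :
    LineTiles (punctTile k m l) {y | (m : ℤ) ≤ (y - H) % ((k : ℤ) + l + m)} := by
  set N : ℤ := (k : ℤ) + l + m with hN
  have hN0 : 0 < N := by omega
  refine ⟨fun y => H - k + N * ((y - H + k) / N), fun _ => 1, ?_⟩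
  intro x hx
  simp only [Set.mem_ofPred_eq] at hx
  have hxr0 := Int.emod_nonneg (x - H + k) hN0.ne'
  have hxr1 := Int.emod_lt_of_pos (x - H + k) hN0
  have hxe := Int.mul_ediv_add_emod (x - H + k) N
  set q := (x - H + k) / N with hq
  set r := (x - H + k) % N with hr
  refine ⟨Or.inl rfl, ?_, ?_⟩
  · have hval : x - (H - k + N * q) = r := by linarith
    change 1 * (x - (H - k + N * q)) ∈ _
    rw [one_mul, hval]
    clear_value r q
    simp only [punctTile, Set.mem_ofPred_eq]
    by_contra hcon
    have h1 := (divmod_of N q (r - k) (by omega) (by omega)).2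
    have h2 : N * q + (r - k) = x - H := by linarith
    rw [h2] at h1
    omega
  · intro y hy
    simp only [punctTile, Set.mem_ofPred_eq, one_mul] at hy
    obtain ⟨s, hs⟩ : ∃ s, s = y - (H - k + N * q) := ⟨_, rfl⟩
    rw [← hs] at hy
    have hd := (divmod_of N q s (by omega) (by omega)).1
    have h2 : N * q + s = y - H + k := by linarith
    rw [h2] at hd
    refine ⟨?_, ?_, rfl⟩
    swap
    · change H - k + N * ((y - H + k) / N) = H - k + N * q
      rw [hd]
    simp only [Set.mem_ofPred_eq]
    rcases hy with hy | hy
    · have h1 := (divmod_of N (q - 1) (s - k + N) (by omega) (by omega)).2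
      have h3 : N * (q - 1) + (s - k + N) = y - H := by linarith
      rw [h3] at h1
      omega
    · have h1 := (divmod_of N q (s - k) (by omega) (by omega)).2
      have h3 : N * q + (s - k) = y - H := by linarith
      rw [h3] at h1
      omega

theorem lineTiles_block (k l m n : ℕ) (hm : 0 < m) (hn : n * m = k + l + m) (h : ℤ)
    (h0 : 0 ≤ h) (h1 : h < n) :
    LineTiles (punctTile k m l) {y | (y / (m : ℤ)) % (n : ℤ) ≠ h} := by
  convert lineTiles_string k l m hm (h * m) using 1
  ext y
  simp only [Set.mem_ofPred_eq]
  have hN : (k : ℤ) + l + m = (n : ℤ) * m := by exact_mod_cast hn.symm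
  rw [hN]
  have hm' : (0 : ℤ) < m := by exact_mod_cast hm
  have e1 := Int.mul_ediv_add_emod y m
  have e2 := Int.mul_ediv_add_emod (y / m) n
  have b1 := Int.emod_nonneg y hm'.ne'
  have b2 := Int.emod_lt_of_pos y hm'
  have b3 := Int.emod_nonneg (y / m) (b := n) (by omega)
  have b4 := Int.emod_lt_of_pos (y / m) (b := n) (by omega)
  set a := y / (m : ℤ) with ha
  set r := y % (m : ℤ) with hr
  set u := a % (n : ℤ) with hu
  set v := a / (n : ℤ) with hv
  have hy : y - h * m = ((n : ℤ) * m) * v + ((u - h) * m + r) := by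
    rw [← e1, ← e2]; ring
  rcases lt_trichotomy u h with hlt | heq | hgt
  · have hd := (divmod_of ((n : ℤ) * m) (v - 1) ((u - h + n) * m + r)
      (by nlinarith) (by nlinarith)).2
    have h3 : (n : ℤ) * m * (v - 1) + ((u - h + n) * m + r) = y - h * m := by rw [hy]; ring
    rw [h3] at hd
    rw [hd]
    constructor
    · intro _; nlinarith
    · intro _; omega
  · have hd := (divmod_of ((n : ℤ) * m) v r b1 (by nlinarith)).2
    have h3 : (n : ℤ) * m * v + r = y - h * m := by rw [hy, heq]; ring
    rw [h3] at hd
    rw [hd]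
    constructor
    · intro hh; exact absurd heq hh
    · intro hh; omega
  · have hd := (divmod_of ((n : ℤ) * m) v ((u - h) * m + r) (by nlinarith) (by nlinarith)).2
    rw [← hy] at hd
    rw [hd]
    constructor
    · intro _; nlinarith
    · intro _; omega

/-- The colour missing at height `(k + l) * j + r`. -/
def missCol (k m j r : ℤ) : ℤ :=
  if r < m then (2 * j + 2) % 3 else if r < k then (2 * j + 1) % 3
  else if r < k + m then (2 * j) % 3 else (2 * j + 2) % 3

/-- The index of the vertical tile of colour `c` at height `(k + l) * j + r`. -/
def tileIdx (k m c j r : ℤ) : ℤ :=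
  if r < m then (if (2 * j) % 3 = c then 2 * j else 2 * j - 2)
  else if r < k then (if (2 * j) % 3 = c then 2 * j else 2 * j - 1)
  else if r < k + m then (if (2 * j + 1) % 3 = c then 2 * j + 1 else 2 * j - 1)
  else (if (2 * j) % 3 = c then 2 * j else 2 * j + 1)

theorem tileIdx_col (k m c j r : ℤ) (hc0 : 0 ≤ c) (hc : c < 3) (hz : missCol k m j r ≠ c) :
    tileIdx k m c j r % 3 = c := by
  unfold missCol at hz
  unfold tileIdx
  obtain ⟨w, hw⟩ : ∃ w, j = 3 * w ∨ j = 3 * w + 1 ∨ j = 3 * w + 2 := ⟨j / 3, by omega⟩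
  rcases hw with rfl | rfl | rfl <;> split_ifs at hz ⊢ <;> omega

theorem lineTiles_column (k l m : ℕ) (hm : 0 < m) (hmk : m < k) (hml : m < l) (c : ℤ)
    (hc0 : 0 ≤ c) (hc : c < 3) :
    LineTiles (punctTile k m l)
      {z | missCol k m (z / ((k : ℤ) + l)) (z % ((k : ℤ) + l)) ≠ c} := by
  set M : ℤ := (k : ℤ) + l with hM
  have hM0 : 0 < M := by omega
  set I : ℤ → ℤ := fun z => tileIdx k m c (z / M) (z % M) with hI
  refine ⟨fun z => if I z % 2 = 0 then M * (I z / 2) else M * (I z / 2) + (k + M + m - 1),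
    fun z => if I z % 2 = 0 then 1 else -1, ?_⟩
  -- the set of each tile of colour `c`
  have even_case : ∀ j s : ℤ, (2 * j) % 3 = c → s ∈ punctTile k m l →
      missCol k m ((M * j + s) / M) ((M * j + s) % M) ≠ c ∧ I (M * j + s) = 2 * j := by
    intro j s hj hs
    simp only [punctTile, Set.mem_ofPred_eq] at hs
    simp only [hI]
    by_cases hsM : s < M
    · obtain ⟨d1, d2⟩ := divmod_of M j s (by omega) hsM
      rw [d1, d2]
      unfold missCol tileIdx
      constructor <;> split_ifs <;> omega
    · obtain ⟨d1, d2⟩ := divmod_of M (j + 1) (s - M) (by omega) (by omega)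
      have h3 : M * (j + 1) + (s - M) = M * j + s := by ring
      rw [h3] at d1 d2
      rw [d1, d2]
      unfold missCol tileIdx
      constructor <;> split_ifs <;> omega
  have odd_case : ∀ j s : ℤ, (2 * j + 1) % 3 = c → s ∈ punctTile k m l →
      missCol k m ((M * j + (k + M + m - 1) - s) / M) ((M * j + (k + M + m - 1) - s) % M) ≠ c ∧
        I (M * j + (k + M + m - 1) - s) = 2 * j + 1 := by
    intro j s hj hs
    simp only [punctTile, Set.mem_ofPred_eq] at hs
    simp only [hI]
    by_cases hsM : k + M + m - 1 - s < M
    · obtain ⟨d1, d2⟩ := divmod_of M j (k + M + m - 1 - s) (by omega) hsM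
      have h3 : M * j + (k + M + m - 1 - s) = M * j + (k + M + m - 1) - s := by ring
      rw [h3] at d1 d2
      rw [d1, d2]
      unfold missCol tileIdx
      constructor <;> split_ifs <;> omega
    · obtain ⟨d1, d2⟩ := divmod_of M (j + 1) (k + m - 1 - s) (by omega) (by omega)
      have h3 : M * (j + 1) + (k + m - 1 - s) = M * j + (k + M + m - 1) - s := by ring
      rw [h3] at d1 d2
      rw [d1, d2]
      unfold missCol tileIdx
      constructor <;> split_ifs <;> omega
  intro z hz
  simp only [Set.mem_ofPred_eq] at hz
  have hr0 := Int.emod_nonneg z hM0.ne'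
  have hr1 := Int.emod_lt_of_pos z hM0
  have hze := Int.mul_ediv_add_emod z M
  obtain ⟨j, hj⟩ : ∃ j, j = z / M := ⟨_, rfl⟩
  obtain ⟨r, hr⟩ : ∃ r, r = z % M := ⟨_, rfl⟩
  have hIz : I z = tileIdx k m c j r := by simp only [hI, hj, hr]
  rw [← hj, ← hr] at hz hze
  rw [← hr] at hr0 hr1
  have hcol : I z % 3 = c := by
    rw [hIz]
    exact tileIdx_col k m c j r hc0 hc hz
  rcases Int.emod_two_eq_zero_or_one (I z) with hpar | hpar
  · obtain ⟨i, hi⟩ : ∃ i, I z = 2 * i := ⟨I z / 2, by omega⟩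
    have hi2 : I z / 2 = i := by omega
    simp only [hpar, if_true, hi2, one_mul]
    refine ⟨by simp, ?_, ?_⟩
    · have hcase : (i = j ∧ (r < k ∨ k + m ≤ r)) ∨ (i = j - 1 ∧ r < m) := by
        rw [hi] at hIz
        unfold missCol at hz
        unfold tileIdx at hIz
        split_ifs at hz hIz <;> omega
      simp only [punctTile, Set.mem_ofPred_eq]
      rcases hcase with ⟨rfl, h⟩ | ⟨rfl, h⟩
      · have : z - M * i = r := by linarith
        rw [this]; omega
      · have : z - M * (j - 1) = r + M := by linarith
        rw [this]; omega
    · intro y hy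
      obtain ⟨g1, g2⟩ := even_case i (y - M * i) (by omega) hy
      have h3 : M * i + (y - M * i) = y := by ring
      rw [h3] at g1 g2
      refine ⟨g1, ?_, ?_⟩
      · rw [g2, if_pos (by omega)]
        congr 1; omega
      · rw [g2, if_pos (by omega)]
  · obtain ⟨i, hi⟩ : ∃ i, I z = 2 * i + 1 := ⟨I z / 2, by omega⟩
    have hi2 : I z / 2 = i := by omega
    have hne : ¬ (I z % 2 = 0) := by omega
    simp only [if_neg hne, hi2]
    refine ⟨by simp, ?_, ?_⟩
    · have hcase : (i = j ∧ k ≤ r) ∨ (i = j - 1 ∧ m ≤ r ∧ r < k + m) := by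
        rw [hi] at hIz
        unfold missCol at hz
        unfold tileIdx at hIz
        split_ifs at hz hIz <;> omega
      simp only [punctTile, Set.mem_ofPred_eq]
      rcases hcase with ⟨rfl, h⟩ | ⟨rfl, h⟩
      · have : -1 * (z - (M * i + (k + M + m - 1))) = k + M + m - 1 - r := by linarith
        rw [this]; omega
      · have : -1 * (z - (M * (j - 1) + (k + M + m - 1))) = k + m - 1 - r := by linarith
        rw [this]; omega
    · intro y hy
      obtain ⟨g1, g2⟩ := odd_case i _ (by omega) hy
      have h3 : M * i + (k + M + m - 1) - (-1 * (y - (M * i + (k + M + m - 1)))) = y := by ring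
      rw [h3] at g1 g2
      have hne' : ¬ ((2 * i + 1) % 2 = 0) := by omega
      refine ⟨g1, ?_, ?_⟩
      · rw [g2, if_neg hne']
        congr 2; omega
      · rw [g2, if_neg hne']

/-- The colour (`0`, `1`, `2`, or `3` for none) of a cell of the `2t × 2t` torus. -/
def cellCol (t X Y : ℤ) : ℤ :=
  if X < t ∧ Y = X then 0 else if t ≤ X ∧ Y = X - t then 1
  else if X < t ∧ Y = X + t then 2 else 3

/-- The direction of the tile at a cell `(X, Y)` in a layer with missing colour `e`. -/
def cellDir (t X Y e : ℤ) : Fin 3 :=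
  if cellCol t X Y ≠ 3 ∧ cellCol t X Y ≠ e then 2 else if e = 1 then 0 else 1

theorem cellDir_two (t X Y e : ℤ) :
    cellDir t X Y e = 2 ↔ (cellCol t X Y ≠ 3 ∧ e ≠ cellCol t X Y) := by
  unfold cellDir
  split_ifs with h1 h2
  · simp [h1.1, h1.2.symm]
  · simp only [Fin.reduceEq, false_iff]; tauto
  · simp only [Fin.reduceEq, false_iff]; tauto

theorem cellDir_zero (t X Y e : ℤ) :
    cellDir t X Y e = 0 ↔ (e = 1 ∧ ¬ (cellCol t X Y ≠ 3 ∧ cellCol t X Y ≠ e)) := by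
  unfold cellDir
  split_ifs with h1 h2
  · simp only [Fin.reduceEq, false_iff]; tauto
  · simp; tauto
  · simp; tauto

theorem cellDir_one (t X Y e : ℤ) :
    cellDir t X Y e = 1 ↔ (e ≠ 1 ∧ ¬ (cellCol t X Y ≠ 3 ∧ cellCol t X Y ≠ e)) := by
  unfold cellDir
  split_ifs with h1 h2
  · simp only [Fin.reduceEq, false_iff]; tauto
  · simp; tauto
  · simp; tauto

theorem missCol_range (k m j r : ℤ) : 0 ≤ missCol k m j r ∧ missCol k m j r < 3 := by
  unfold missCol
  split_ifs <;> omega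

theorem cellCol_range (t X Y : ℤ) : 0 ≤ cellCol t X Y ∧ cellCol t X Y ≤ 3 := by
  unfold cellCol
  split_ifs <;> omega

/-- If `m < min{k, ℓ}` and `2m ∣ k + ℓ + m`, then `k(m)ℓ` tiles `ℤ^3`. -/
theorem general_gap_tiles_Z3 (k l m : ℕ) (hk : 0 < k) (hl : 0 < l) (hm : 0 < m)
    (hmk : m < k) (hml : m < l) (hdvd : 2 * m ∣ k + l + m) :
    TilesZd 3 (punctTile k m l) := by
  obtain ⟨t, ht⟩ := hdvd
  have hn : (2 * t) * m = k + l + m := by rw [ht]; ring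
  have ht0 : 0 < t := by
    rcases Nat.eq_zero_or_pos t with h | h
    · subst h; omega
    · exact h
  have hrange : ∀ x : ℤ, 0 ≤ (x / m) % ((2 * t : ℕ) : ℤ) ∧ (x / m) % ((2 * t : ℕ) : ℤ) < 2 * t := by
    intro x
    have h1 := Int.emod_nonneg (x / m) (b := ((2 * t : ℕ) : ℤ)) (by omega)
    have h2 := Int.emod_lt_of_pos (x / m) (b := ((2 * t : ℕ) : ℤ)) (by omega)
    push_cast at h1 h2 ⊢
    exact ⟨h1, h2⟩
  apply tiles_of_lines_s19 _ (fun p : Fin 3 → ℤ =>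
    cellDir t ((p 0 / m) % ((2 * t : ℕ) : ℤ)) ((p 1 / m) % ((2 * t : ℕ) : ℤ))
      (missCol k m (p 2 / ((k : ℤ) + l)) (p 2 % ((k : ℤ) + l))))
  intro p i
  obtain ⟨e0, e3⟩ := missCol_range k m (p 2 / ((k : ℤ) + l)) (p 2 % ((k : ℤ) + l))
  obtain ⟨X0, X1⟩ := hrange (p 0)
  obtain ⟨Y0, Y1⟩ := hrange (p 1)
  fin_cases i
  · simp only [Fin.zero_eta, Fin.isValue, Function.update_self, ne_eq, one_ne_zero,
      not_false_eq_true, Function.update_of_ne, Fin.reduceEq, cellDir_zero]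
    generalize missCol k m (p 2 / ((k : ℤ) + l)) (p 2 % ((k : ℤ) + l)) = e at *
    generalize (p 1 / m) % ((2 * t : ℕ) : ℤ) = Y at *
    by_cases he : e = 1
    · have := lineTiles_block k l m (2 * t) hm hn (if Y < t then Y else Y - t)
        (by split_ifs <;> omega) (by push_cast; split_ifs <;> omega)
      convert this using 1
      ext x
      obtain ⟨x0, x1⟩ := hrange x
      simp only [Set.mem_ofPred_eq]
      generalize (x / m) % ((2 * t : ℕ) : ℤ) = X at *
      unfold cellCol
      split_ifs <;> omega
    · convert lineTiles_empty _ using 1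
      ext x
      simp [he]
  · simp only [Fin.mk_one, Fin.isValue, Function.update_self, ne_eq, zero_ne_one,
      not_false_eq_true, Function.update_of_ne, Fin.reduceEq, cellDir_one]
    generalize missCol k m (p 2 / ((k : ℤ) + l)) (p 2 % ((k : ℤ) + l)) = e at *
    generalize (p 0 / m) % ((2 * t : ℕ) : ℤ) = X at *
    by_cases he : e = 1
    · convert lineTiles_empty _ using 1
      ext x
      simp [he]
    · have := lineTiles_block k l m (2 * t) hm hn
        (if t ≤ X then X - t else if e = 2 then X else X + t)
        (by split_ifs <;> omega) (by push_cast; split_ifs <;> omega)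
      convert this using 1
      ext y
      obtain ⟨x0, x1⟩ := hrange y
      simp only [Set.mem_ofPred_eq]
      generalize (y / m) % ((2 * t : ℕ) : ℤ) = Y at *
      unfold cellCol
      split_ifs <;> omega
  · simp only [Fin.reduceFinMk, Fin.isValue, Function.update_self, ne_eq,
      not_false_eq_true, Function.update_of_ne, Fin.reduceEq, cellDir_two]
    generalize (p 0 / m) % ((2 * t : ℕ) : ℤ) = X at *
    generalize (p 1 / m) % ((2 * t : ℕ) : ℤ) = Y at *
    obtain ⟨c0, c1⟩ := cellCol_range t X Y
    generalize cellCol t X Y = c at *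
    by_cases hc : c = 3
    · convert lineTiles_empty _ using 1
      ext x
      simp [hc]
    · have := lineTiles_column k l m hm hmk hml c c0 (by omega)
      simpa [hc] using this
end
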